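/- Let H be an N×N hermitian Wigner matrix satisfying condition C1. For any κ > 0 there exist constants C, c > 0, depending on κ, such that P( there exists a unit vector v with Hv = μv for some μ ∈ [−2+κ, 2−κ] and ‖v‖_∞ ≥ M N^{−1/2} ) ≤ C e^{−c√M} for all M ≥ (log N)⁴ and all N large enough. -/

import Mathlib

open MeasureTheory ProbabilityTheory
open scoped ENNReal NNReal

noncomputable section

/-- The density of the Wigner semicircle law. -/
def rhoSC (x : ℝ) : ℝ := if |x| ≤ 2 then Real.sqrt (4 - x ^ 2) / (2 * Real.pi) else 0

/-- The Stieltjes transform of the Wigner semicircle law. -/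
def mSC (z : ℂ) : ℂ := ∫ x : ℝ, (rhoSC x : ℂ) / ((x : ℂ) - z)

/-- The Stieltjes transform of the empirical eigenvalue distribution of a matrix:
`m(z) = N⁻¹ Tr (H - z)⁻¹`. -/
def stTrans {N : ℕ} (A : Matrix (Fin N) (Fin N) ℂ) (z : ℂ) : ℂ :=
  (Matrix.trace (A - z • (1 : Matrix (Fin N) (Fin N) ℂ))⁻¹) / (N : ℂ)

open scoped Classical in
/-- The number of eigenvalues (with multiplicity) of a Hermitian matrix lying in a set `I`. -/
def eigCount {N : ℕ} {A : Matrix (Fin N) (Fin N) ℂ} (hA : A.IsHermitian) (I : Set ℝ) : ℕ :=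
  (Finset.univ.filter fun i => hA.eigenvalues i ∈ I).card

/-- `ν` has a strictly positive density `h` on `ℝ² ≃ ℂ` which is either a product of two copies
of a one-variable function or radially symmetric. -/
def WignerDensityOf (ν : Measure ℂ) (h : ℝ → ℝ → ℝ) : Prop :=
  (∀ x y, 0 < h x y) ∧
  ν = (volume : Measure ℂ).withDensity (fun z => ENNReal.ofReal (h z.re z.im)) ∧
  ((∃ hs : ℝ → ℝ, ∀ x y, h x y = hs x * hs y) ∨
   (∃ hs : ℝ → ℝ, ∀ x y, h x y = hs (x ^ 2 + y ^ 2)))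

/-- Condition C1, with explicit constants: Gaussian moments of the off-diagonal law `ν`
and of the diagonal law `ν'` are bounded by `D` resp. `D'`. -/
def CondC1 (ν : Measure ℂ) (ν' : Measure ℝ) (δ₀ D D' : ℝ) : Prop :=
  0 < δ₀ ∧
  (∫⁻ z, ENNReal.ofReal (Real.exp (δ₀ * ‖z‖ ^ 2)) ∂ν) ≤ ENNReal.ofReal D ∧
  (∫⁻ x, ENNReal.ofReal (Real.exp (δ₀ * x ^ 2)) ∂ν') ≤ ENNReal.ofReal D'

/-- `H` is an `N × N` hermitian Wigner ensemble on the probability space `(Ω, P)`: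
the entries above the diagonal are i.i.d. with law `N^{-1/2} ν` where `ν` has mean zero,
variance one and a density as in `WignerDensityOf`; the diagonal entries are real i.i.d.
with law `N^{-1/2} ν'`, `ν'` of mean zero; and all these entries are independent. -/
structure IsWignerMatrix {Ω : Type} [MeasurableSpace Ω] (P : Measure Ω) (N : ℕ)
    (H : Ω → Matrix (Fin N) (Fin N) ℂ) (ν : Measure ℂ) (ν' : Measure ℝ) : Prop where
  herm : ∀ ω, (H ω).IsHermitian
  prob : IsProbabilityMeasure P
  probν : IsProbabilityMeasure ν
  probν' : IsProbabilityMeasure ν'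
  density : ∃ h, WignerDensityOf ν h
  mean : (∫ z, z ∂ν) = 0
  var : (∫ z, ‖z‖ ^ 2 ∂ν) = 1
  mean' : (∫ x, x ∂ν') = 0
  offdiag : ∀ i j : Fin N, i < j →
    P.map (fun ω => (Real.sqrt N : ℂ) * H ω i j) = ν
  diag : ∀ i : Fin N, P.map (fun ω => Real.sqrt N * (H ω i i).re) = ν'
  diag_real : ∀ ω i, (H ω i i).im = 0
  indep : iIndepFun
    (fun (p : {p : Fin N × Fin N // p.1 ≤ p.2}) (ω : Ω) => H ω p.1.1 p.1.2) P
/-- The Fourier transform on `ℝ²` of a real function of two variables. -/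
def fourier2 (f : ℝ → ℝ → ℝ) (t s : ℝ) : ℂ :=
  ∫ x : ℝ, ∫ y : ℝ, Complex.exp (-Complex.I * (t * x + s * y)) * (f x y : ℂ)

/-- The Laplacian of a function of two real variables. -/
def laplacian2 (g : ℝ → ℝ → ℝ) (x y : ℝ) : ℝ :=
  deriv (deriv (fun t => g t y)) x + deriv (deriv (fun t => g x t)) y

/-- Condition C2 with exponent `a` and constants `w`, `w'`: decay of the Fourier transforms
of the density `h` and of `h · Δ(-log h)`. -/
def CondC2 (h : ℝ → ℝ → ℝ) (a : ℕ) (w w' : ℝ) : Prop :=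
  0 < w ∧ 0 < w' ∧
  (∀ t s : ℝ, ‖fourier2 h t s‖ ≤ 1 / (1 + w * (t ^ 2 + s ^ 2)) ^ a) ∧
  (∀ t s : ℝ, ‖fourier2
      (fun x y => h x y * laplacian2 (fun u v => -Real.log (h u v)) x y) t s‖
    ≤ 1 / (1 + w' * (t ^ 2 + s ^ 2)) ^ a)

/-- Either the real and imaginary parts under `ν` are i.i.d., or `ν` is rotationally
symmetric. -/
def ComplexSymm (ν : Measure ℂ) : Prop :=
  (∃ μ₀ : Measure ℝ,
    ν = Measure.map (fun p : ℝ × ℝ => (p.1 : ℂ) + p.2 * Complex.I) (μ₀.prod μ₀)) ∨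
  (∀ θ : ℝ, Measure.map (fun z => Complex.exp (θ * Complex.I) * z) ν = ν)


structure SG (δ D : ℝ) (μ : Measure ℂ) : Prop where
  pos : 0 < δ
  prob : IsProbabilityMeasure μ
  mean : ∫ z, z ∂μ = 0
  var : ∫ z, ‖z‖ ^ 2 ∂μ = 1
  mom : ∫⁻ z, ENNReal.ofReal (Real.exp (δ * ‖z‖ ^ 2)) ∂μ ≤ ENNReal.ofReal D

lemma exp_le_add_exp_sq (x : ℝ) : Real.exp x ≤ x + Real.exp (x ^ 2) := by
  have h1 := Real.add_one_le_exp (x ^ 2)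
  by_cases h : |x| ≤ 1
  · have := (abs_le.1 (Real.abs_exp_sub_one_sub_id_le h)).2
    linarith
  · rcases le_total 0 x with hx | hx
    · rw [abs_of_nonneg hx] at h
      have : Real.exp x ≤ Real.exp (x ^ 2) := Real.exp_le_exp.2 (by nlinarith)
      linarith
    · rw [abs_of_nonpos hx] at h
      have : Real.exp x ≤ 1 := Real.exp_le_one_iff.2 hx
      nlinarith

namespace SG
variable {δ D : ℝ} {μ : Measure ℂ}

lemma integrable_exp (h : SG δ D μ) : Integrable (fun z => Real.exp (δ * ‖z‖ ^ 2)) μ := by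
  refine ⟨by fun_prop, ?_⟩
  rw [hasFiniteIntegral_iff_ofReal (Filter.Eventually.of_forall fun z => (Real.exp_pos _).le)]
  exact h.mom.trans_lt ENNReal.ofReal_lt_top

lemma one_le (h : SG δ D μ) : 1 ≤ D := by
  have := h.prob
  have h1 : ∫⁻ z, (1 : ℝ≥0∞) ∂μ ≤ ∫⁻ z, ENNReal.ofReal (Real.exp (δ * ‖z‖ ^ 2)) ∂μ := by
    apply lintegral_mono
    intro z
    have : (1 : ℝ) ≤ Real.exp (δ * ‖z‖ ^ 2) := Real.one_le_exp (mul_nonneg h.pos.le (sq_nonneg _))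
    simpa using ENNReal.ofReal_le_ofReal this
  have h2 := h1.trans h.mom
  simp only [lintegral_const, measure_univ, mul_one] at h2
  exact ENNReal.one_le_ofReal.1 h2

lemma integral_exp_le (h : SG δ D μ) : ∫ z, Real.exp (δ * ‖z‖ ^ 2) ∂μ ≤ D := by
  rw [integral_eq_lintegral_of_nonneg_ae (Filter.Eventually.of_forall fun z => (Real.exp_pos _).le)
    (by fun_prop)]
  refine (ENNReal.toReal_mono ENNReal.ofReal_ne_top h.mom).trans ?_
  rw [ENNReal.toReal_ofReal (by linarith [h.one_le])]

lemma lintegral_le_of_integral {f : ℂ → ℝ} {b : ℝ} (hf : Integrable f μ) (h0 : ∀ z, 0 ≤ f z)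
    (hb : ∫ z, f z ∂μ ≤ b) : ∫⁻ z, ENNReal.ofReal (f z) ∂μ ≤ ENNReal.ofReal b := by
  rw [← ofReal_integral_eq_lintegral_ofReal hf (Filter.Eventually.of_forall h0)]
  exact ENNReal.ofReal_le_ofReal hb

lemma integrable_id (h : SG δ D μ) : Integrable (fun z : ℂ => z) μ := by
  have hp := h.pos
  refine (h.integrable_exp.const_mul (1 / δ + 1)).mono' (by fun_prop) ?_
  filter_upwards with z
  have h1 := Real.add_one_le_exp (δ * ‖z‖ ^ 2)
  have h2 : ‖z‖ ≤ ‖z‖ ^ 2 + 1 := by nlinarith [sq_nonneg (‖z‖ - 1)]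
  have h3 : (1 / δ + 1) * (δ * ‖z‖ ^ 2 + 1) = ‖z‖ ^ 2 + 1 + (1 / δ + δ * ‖z‖ ^ 2) := by
    field_simp; ring
  have h4 : 0 ≤ 1 / δ + δ * ‖z‖ ^ 2 := by positivity
  calc ‖z‖ ≤ (1 / δ + 1) * (δ * ‖z‖ ^ 2 + 1) := by linarith
    _ ≤ _ := by gcongr

lemma lin (h : SG δ D μ) (a : ℂ) :
    ∫⁻ z, ENNReal.ofReal (Real.exp (a * z).re) ∂μ ≤
      ENNReal.ofReal (Real.exp ((1 + D) / δ * ‖a‖ ^ 2)) := by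
  have hp := h.pos
  have hD := h.one_le
  have := h.prob
  have hre : ∀ z, |(a * z).re| ≤ ‖a‖ * ‖z‖ := fun z => by
    simpa using Complex.abs_re_le_norm (a * z)
  have hint : Integrable (fun z => (a * z).re) μ := (h.integrable_id.const_mul a).re
  have hmean : ∫ z, (a * z).re ∂μ = 0 := by
    have h1 := integral_re (𝕜 := ℂ) (h.integrable_id.const_mul a)
    simp only [RCLike.re_to_complex] at h1
    rw [h1, integral_const_mul, h.mean]; simp
  by_cases ha : ‖a‖ ^ 2 ≤ δ
  · set t := ‖a‖ ^ 2 / δ with ht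
    have ht0 : 0 ≤ t := by positivity
    have ht1 : t ≤ 1 := by rw [ht, div_le_one hp]; exact ha
    have hb : ∀ z, Real.exp (a * z).re ≤ (a * z).re + (1 - t + t * Real.exp (δ * ‖z‖ ^ 2)) := by
      intro z
      refine (exp_le_add_exp_sq _).trans ?_
      have h1 : (a * z).re ^ 2 ≤ t * (δ * ‖z‖ ^ 2) := by
        have : t * (δ * ‖z‖ ^ 2) = (‖a‖ * ‖z‖) ^ 2 := by rw [ht]; field_simp
        rw [this]
        exact sq_le_sq' (by linarith [(abs_le.1 (hre z)).1]) (abs_le.1 (hre z)).2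
      have h2 := convexOn_exp.2 (Set.mem_univ (0:ℝ)) (Set.mem_univ (δ * ‖z‖ ^ 2))
        (by linarith : 0 ≤ 1 - t) ht0 (by ring)
      simp only [smul_eq_mul, mul_zero, zero_add, Real.exp_zero, mul_one] at h2
      have h3 := Real.exp_le_exp.2 h1
      linarith
    have hi2 : Integrable (fun z => 1 - t + t * Real.exp (δ * ‖z‖ ^ 2)) μ :=
      (integrable_const _).add (h.integrable_exp.const_mul t)
    have hi3 : Integrable (fun z => Real.exp (a * z).re) μ := by
      refine (hint.add hi2).mono' (by fun_prop) ?_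
      filter_upwards with z
      rw [Real.norm_of_nonneg (Real.exp_pos _).le]
      exact hb z
    refine lintegral_le_of_integral hi3 (fun z => (Real.exp_pos _).le) ?_
    calc _ ≤ ∫ z, ((a * z).re + (1 - t + t * Real.exp (δ * ‖z‖ ^ 2))) ∂μ :=
          integral_mono hi3 (hint.add hi2) hb
      _ = 0 + ((1 - t) + t * ∫ z, Real.exp (δ * ‖z‖ ^ 2) ∂μ) := by
          rw [integral_add hint hi2, hmean, integral_add (integrable_const _)
            (h.integrable_exp.const_mul t), integral_const_mul]
          simp
      _ ≤ (1 + D) * t + 1 := by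
          have := mul_le_mul_of_nonneg_left h.integral_exp_le ht0
          nlinarith
      _ ≤ _ := by
          refine (Real.add_one_le_exp _).trans_eq ?_
          rw [ht]; congr 1; ring
  · push Not at ha
    have hb : ∀ z, Real.exp (a * z).re ≤ Real.exp (‖a‖ ^ 2 / δ) * Real.exp (δ * ‖z‖ ^ 2) := by
      intro z
      rw [← Real.exp_add]
      apply Real.exp_le_exp.2
      have h1 := (abs_le.1 (hre z)).2
      have h2 : 0 ≤ (‖a‖ / δ - ‖z‖) ^ 2 * δ := by positivity
      have h3 : (‖a‖ / δ - ‖z‖) ^ 2 * δ = ‖a‖ ^ 2 / δ + δ * ‖z‖ ^ 2 - 2 * (‖a‖ * ‖z‖) := by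
        field_simp; ring
      have h4 : 0 ≤ ‖a‖ * ‖z‖ := by positivity
      linarith
    calc _ ≤ ∫⁻ z, ENNReal.ofReal (Real.exp (‖a‖ ^ 2 / δ)) *
            ENNReal.ofReal (Real.exp (δ * ‖z‖ ^ 2)) ∂μ := by
          apply lintegral_mono
          intro z
          simp only
          rw [← ENNReal.ofReal_mul (Real.exp_pos _).le]
          exact ENNReal.ofReal_le_ofReal (hb z)
      _ = ENNReal.ofReal (Real.exp (‖a‖ ^ 2 / δ)) *
            ∫⁻ z, ENNReal.ofReal (Real.exp (δ * ‖z‖ ^ 2)) ∂μ := by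
          rw [lintegral_const_mul]; fun_prop
      _ ≤ ENNReal.ofReal (Real.exp (‖a‖ ^ 2 / δ)) * ENNReal.ofReal D := by
          gcongr; exact h.mom
      _ ≤ _ := by
          rw [← ENNReal.ofReal_mul (Real.exp_pos _).le]
          apply ENNReal.ofReal_le_ofReal
          have h1 : D ≤ Real.exp (D * (‖a‖ ^ 2 / δ)) := by
            have : 1 ≤ ‖a‖ ^ 2 / δ := by rw [le_div_iff₀ hp]; linarith
            have h2 := Real.add_one_le_exp (D * (‖a‖ ^ 2 / δ))
            nlinarith
          calc _ ≤ Real.exp (‖a‖ ^ 2 / δ) * Real.exp (D * (‖a‖ ^ 2 / δ)) := by gcongr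
            _ = _ := by rw [← Real.exp_add]; congr 1; ring

lemma exp_le_quad {x y T : ℝ} (hx : |x| ≤ T * y) (_ : 0 ≤ T) (hy : 0 ≤ y) (hT : T ≤ 1 / 2) :
    Real.exp x ≤ 1 + x + 8 * T ^ 2 * Real.exp y := by
  -- exp x ≤ 1 + x + x^2 exp|x|
  have key : Real.exp x ≤ 1 + x + x ^ 2 * Real.exp |x| := by
    by_cases h : |x| ≤ 1
    · have := (abs_le.1 (Real.abs_exp_sub_one_sub_id_le h)).2
      have h1 := Real.one_le_exp (abs_nonneg x)
      nlinarith [sq_nonneg x]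
    · push Not at h
      have h2 : 1 ≤ x ^ 2 := by rw [← sq_abs]; nlinarith
      rcases le_total 0 x with hx | hx
      · rw [abs_of_nonneg hx] at h ⊢
        nlinarith [Real.exp_pos x]
      · rw [abs_of_nonpos hx] at h ⊢
        have h3 : Real.exp x ≤ 1 := Real.exp_le_one_iff.2 hx
        have h4 := Real.add_one_le_exp (-x)
        nlinarith
  have h1 : x ^ 2 ≤ T ^ 2 * y ^ 2 := by
    rw [← sq_abs, ← mul_pow]; gcongr
  have h2 : Real.exp |x| ≤ Real.exp (y / 2) := Real.exp_le_exp.2 (by nlinarith)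
  have h3 : y ^ 2 ≤ 8 * Real.exp (y / 2) := by
    have := Real.quadratic_le_exp_of_nonneg (by positivity : 0 ≤ y / 2)
    nlinarith
  calc _ ≤ 1 + x + x ^ 2 * Real.exp |x| := key
    _ ≤ 1 + x + (T ^ 2 * (8 * Real.exp (y / 2))) * Real.exp (y / 2) := by gcongr; nlinarith [sq_nonneg T]
    _ = _ := by
      have : Real.exp y = Real.exp (y / 2) * Real.exp (y / 2) := by rw [← Real.exp_add]; congr 1; ring
      rw [this]; ring

lemma integrable_sq (h : SG δ D μ) : Integrable (fun z : ℂ => ‖z‖ ^ 2) μ := by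
  have hp := h.pos
  refine (h.integrable_exp.const_mul (1 / δ)).mono' (by fun_prop) ?_
  filter_upwards with z
  have h1 := Real.add_one_le_exp (δ * ‖z‖ ^ 2)
  rw [Real.norm_of_nonneg (by positivity), one_div, inv_mul_eq_div, le_div_iff₀ hp]
  linarith

lemma quad (h : SG δ D μ) (a : ℝ) (ha : |a| ≤ δ / 2) :
    ∫⁻ z, ENNReal.ofReal (Real.exp (a * (‖z‖ ^ 2 - 1))) ∂μ ≤
      ENNReal.ofReal (Real.exp (8 * Real.exp δ * D / δ ^ 2 * a ^ 2)) := by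
  have hp := h.pos
  have hD := h.one_le
  have := h.prob
  set T := |a| / δ with hTd
  have hT : T ≤ 1 / 2 := by rw [hTd, div_le_iff₀ hp]; linarith
  have hb : ∀ z : ℂ, Real.exp (a * (‖z‖ ^ 2 - 1)) ≤
      1 + a * (‖z‖ ^ 2 - 1) + 8 * T ^ 2 * (Real.exp δ * Real.exp (δ * ‖z‖ ^ 2)) := by
    intro z
    have h1 := exp_le_quad (x := a * (‖z‖ ^ 2 - 1)) (y := δ + δ * ‖z‖ ^ 2) (T := T) (by
      rw [abs_mul, hTd]
      have : |‖z‖ ^ 2 - 1| ≤ 1 + ‖z‖ ^ 2 := abs_le.2 ⟨by nlinarith [sq_nonneg ‖z‖], by linarith⟩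
      calc _ ≤ |a| * (1 + ‖z‖ ^ 2) := by gcongr
        _ = _ := by field_simp) (by positivity) (by positivity) hT
    rwa [Real.exp_add] at h1
  have hi1 : Integrable (fun z : ℂ => a * (‖z‖ ^ 2 - 1)) μ :=
    (h.integrable_sq.sub (integrable_const _)).const_mul a
  have hi1' : Integrable (fun z : ℂ => 1 + a * (‖z‖ ^ 2 - 1)) μ := (integrable_const _).add hi1
  have hi2 : Integrable (fun z : ℂ => 8 * T ^ 2 * (Real.exp δ * Real.exp (δ * ‖z‖ ^ 2))) μ :=
    (h.integrable_exp.const_mul _).const_mul _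
  have hi3 : Integrable (fun z : ℂ => Real.exp (a * (‖z‖ ^ 2 - 1))) μ := by
    refine (hi1'.add hi2).mono' (by fun_prop) ?_
    filter_upwards with z
    rw [Real.norm_of_nonneg (Real.exp_pos _).le]
    exact hb z
  refine lintegral_le_of_integral hi3 (fun z => (Real.exp_pos _).le) ?_
  calc _ ≤ ∫ z, (1 + a * (‖z‖ ^ 2 - 1) + 8 * T ^ 2 * (Real.exp δ * Real.exp (δ * ‖z‖ ^ 2))) ∂μ :=
        integral_mono hi3 (hi1'.add hi2) hb
    _ = 1 + 8 * T ^ 2 * (Real.exp δ * ∫ z, Real.exp (δ * ‖z‖ ^ 2) ∂μ) := by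
        rw [integral_add hi1' hi2, integral_add (integrable_const _) hi1, integral_const_mul,
          integral_const_mul, integral_const_mul,
          integral_sub h.integrable_sq (integrable_const _), h.var]
        simp
    _ ≤ 1 + 8 * T ^ 2 * (Real.exp δ * D) := by gcongr; exact h.integral_exp_le
    _ = 8 * Real.exp δ * D / δ ^ 2 * a ^ 2 + 1 := by
        rw [hTd, div_pow, sq_abs]; ring
    _ ≤ _ := Real.add_one_le_exp _

end SG


lemma lintegral_pi_prod {ι : Type*} [Fintype ι] (μ : ι → Measure ℂ)
    [∀ i, IsProbabilityMeasure (μ i)] (f : ι → ℂ → ℝ≥0∞) (hf : ∀ i, Measurable (f i)) :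
    ∫⁻ x, ∏ i, f i (x i) ∂(Measure.pi μ) = ∏ i, ∫⁻ z, f i z ∂(μ i) := by
  have h := lintegral_prod_eq_prod_lintegral_of_indepFun (μ := Measure.pi μ) Finset.univ
    (fun i x => f i (x i)) (iIndepFun_pi (X := f) (fun i => (hf i).aemeasurable))
    (fun i => (hf i).comp (measurable_pi_apply i))
  rw [h]
  refine Finset.prod_congr rfl fun i _ => ?_
  exact (measurePreserving_eval μ i).lintegral_comp (hf i)

/-- the exponential as an extended nonnegative real -/
def EE (x : ℝ) : ℝ≥0∞ := ENNReal.ofReal (Real.exp x)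

lemma EE_mono {x y : ℝ} (h : x ≤ y) : EE x ≤ EE y :=
  ENNReal.ofReal_le_ofReal (Real.exp_le_exp.2 h)

@[fun_prop]
lemma measurable_EE : Measurable EE := by unfold EE; fun_prop

lemma EE_add (x y : ℝ) : EE (x + y) = EE x * EE y := by
  unfold EE; rw [Real.exp_add, ENNReal.ofReal_mul (Real.exp_pos _).le]

lemma EE_sum {ι : Type*} (s : Finset ι) (f : ι → ℝ) : EE (∑ i ∈ s, f i) = ∏ i ∈ s, EE (f i) := by
  unfold EE; rw [Real.exp_sum, ENNReal.ofReal_prod_of_nonneg (fun i _ => (Real.exp_pos _).le)]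

lemma EE_zero : EE 0 = 1 := by simp [EE]

lemma EE_ne_top (x : ℝ) : EE x ≠ ⊤ := ENNReal.ofReal_ne_top

section forms
variable {ι : Type*} [Fintype ι] {δ D : ℝ} {μ : ι → Measure ℂ}

lemma lin_form (hμ : ∀ i, SG δ D (μ i)) (a : ι → ℂ) :
    ∫⁻ x, EE (∑ j, a j * x j).re ∂(Measure.pi μ) ≤ EE ((1 + D) / δ * ∑ j, ‖a j‖ ^ 2) := by
  have := fun i => (hμ i).prob
  have h1 : ∀ x : ι → ℂ, EE (∑ j, a j * x j).re = ∏ j, EE (a j * x j).re := by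
    intro x; rw [Complex.re_sum, EE_sum]
  simp_rw [h1]
  rw [lintegral_pi_prod μ (fun j z => EE (a j * z).re) (fun j => by fun_prop), Finset.mul_sum,
    EE_sum]
  exact Finset.prod_le_prod' fun j _ => (hμ j).lin (a j)

/-- a Gaussian constant -/
def KG : ℝ≥0∞ := ∫⁻ g, EE (g ^ 2 / 4) ∂(gaussianReal 0 1)

lemma KG_lt_top : KG < ⊤ := by
  unfold KG
  rw [gaussianReal_of_var_ne_zero _ one_ne_zero,
    lintegral_withDensity_eq_lintegral_mul _ (measurable_gaussianPDF _ _) (by fun_prop)]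
  have h : ∀ g : ℝ, (gaussianPDF 0 1 * fun g => EE (g ^ 2 / 4)) g =
      ENNReal.ofReal ((√(2 * Real.pi))⁻¹ * Real.exp (-(1/4) * g ^ 2)) := by
    intro g
    simp only [Pi.mul_apply, gaussianPDF, gaussianPDFReal, EE, NNReal.coe_one, mul_one, sub_zero]
    rw [← ENNReal.ofReal_mul (by positivity), mul_assoc, ← Real.exp_add]
    congr 3; ring
  simp_rw [h]
  have hi : Integrable (fun g : ℝ => (√(2 * Real.pi))⁻¹ * Real.exp (-(1/4) * g ^ 2)) :=
    (integrable_exp_neg_mul_sq (by norm_num)).const_mul _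
  exact hi.lintegral_lt_top

lemma one_le_KG : 1 ≤ KG := by
  unfold KG
  calc (1 : ℝ≥0∞) = ∫⁻ g, 1 ∂(gaussianReal 0 1) := by simp
    _ ≤ _ := lintegral_mono fun g => by
      rw [← EE_zero]; exact EE_mono (by positivity)

lemma EE_sq (t : ℝ) : EE (t ^ 2 / 2) = ∫⁻ g, EE (t * g) ∂(gaussianReal 0 1) := by
  have h := congrFun (mgf_id_gaussianReal (μ := 0) (v := 1)) t
  simp only [mgf, id, NNReal.coe_one, zero_mul, zero_add, one_mul] at h
  unfold EE
  rw [← h, ofReal_integral_eq_lintegral_ofReal (integrable_exp_mul_gaussianReal t)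
    (Filter.Eventually.of_forall fun g => (Real.exp_pos _).le)]

lemma sq_form_re (hμ : ∀ i, SG δ D (μ i)) (b : ι → ℂ) (s : ℝ) (hs : ∑ j, ‖b j‖ ^ 2 = s) 
    (hB : 0 < (1 + D) / δ) :
    ∫⁻ x, EE ((∑ j, b j * x j).re ^ 2 / (8 * ((1 + D) / δ) * s)) ∂(Measure.pi μ) ≤ KG := by
  have := fun i => (hμ i).prob
  set B := (1 + D) / δ
  have hs0 : 0 ≤ s := hs ▸ Finset.sum_nonneg fun i _ => by positivity
  rcases hs0.eq_or_lt with h0 | h0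
  · simp only [← h0, mul_zero, div_zero, EE_zero]
    simpa using one_le_KG
  set u := (√(4 * B * s))⁻¹ with hu
  have hu2 : u ^ 2 = (4 * B * s)⁻¹ := by rw [hu, inv_pow, Real.sq_sqrt (by positivity)]
  have h1 : ∀ x : ι → ℂ, EE ((∑ j, b j * x j).re ^ 2 / (8 * B * s)) =
      ∫⁻ g, EE ((∑ j, (u * g * b j : ℂ) * x j).re) ∂(gaussianReal 0 1) := by
    intro x
    have : (∑ j, b j * x j).re ^ 2 / (8 * B * s) = (u * (∑ j, b j * x j).re) ^ 2 / 2 := by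
      rw [mul_pow, hu2]; field_simp; ring
    rw [this, EE_sq]
    refine lintegral_congr fun g => ?_
    congr 1
    have : ∑ j, (u * g * b j : ℂ) * x j = ((u * g : ℝ) : ℂ) * ∑ j, b j * x j := by
      rw [Finset.mul_sum]; refine Finset.sum_congr rfl fun j _ => ?_
      push_cast; ring
    rw [this, Complex.re_ofReal_mul]; ring
  simp_rw [h1]
  rw [lintegral_lintegral_swap (by fun_prop)]
  unfold KG
  refine lintegral_mono fun g => ?_
  refine (lin_form hμ _).trans (EE_mono (le_of_eq ?_))
  have : ∑ j, ‖(u * g * b j : ℂ)‖ ^ 2 = u ^ 2 * g ^ 2 * s := by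
    rw [← hs, Finset.mul_sum]
    refine Finset.sum_congr rfl fun j _ => ?_
    rw [norm_mul, norm_mul, Complex.norm_real, Complex.norm_real, mul_pow, mul_pow,
      Real.norm_eq_abs, Real.norm_eq_abs, sq_abs, sq_abs]
  rw [this, hu2]
  change B * _ = _
  field_simp

lemma EE_half (x y : ℝ) : EE ((x + y) / 2) ≤ 2⁻¹ * (EE x + EE y) := by
  have h2 := convexOn_exp.2 (Set.mem_univ x) (Set.mem_univ y)
        (by norm_num : (0:ℝ) ≤ 1/2) (by norm_num : (0:ℝ) ≤ 1/2) (by norm_num)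
  simp only [smul_eq_mul] at h2
  unfold EE
  rw [← ENNReal.ofReal_add (Real.exp_pos _).le (Real.exp_pos _).le]
  have : (2⁻¹ : ℝ≥0∞) = ENNReal.ofReal (1 / 2) := by
    rw [one_div, ENNReal.ofReal_inv_of_pos (by norm_num)]; simp
  rw [this, ← ENNReal.ofReal_mul (by norm_num)]
  apply ENNReal.ofReal_le_ofReal
  have e : (x + y) / 2 = 1/2 * x + 1/2 * y := by ring
  rw [e]; linarith

lemma sq_form (hμ : ∀ i, SG δ D (μ i)) (b : ι → ℂ) (s : ℝ) (hs : ∑ j, ‖b j‖ ^ 2 = s) 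
    (hB : 0 < (1 + D) / δ) :
    ∫⁻ x, EE (‖∑ j, b j * x j‖ ^ 2 / (16 * ((1 + D) / δ) * s)) ∂(Measure.pi μ) ≤ KG := by
  have h1 := sq_form_re hμ b s hs hB
  have h2 := sq_form_re hμ (fun j => -Complex.I * b j) s (by simpa using hs) hB
  have e : ∀ x : ι → ℂ, ‖∑ j, b j * x j‖ ^ 2 / (16 * ((1 + D) / δ) * s) =
     ((∑ j, b j * x j).re ^ 2 / (8 * ((1 + D) / δ) * s) + 
      (∑ j, -Complex.I * b j * x j).re ^ 2 / (8 * ((1 + D) / δ) * s)) / 2 := by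
    intro x
    have : ∑ j, -Complex.I * b j * x j = -Complex.I * ∑ j, b j * x j := by
      rw [Finset.mul_sum]; refine Finset.sum_congr rfl fun j _ => by ring
    rw [this, Complex.sq_norm, Complex.normSq_apply]
    simp only [neg_mul, Complex.neg_re, Complex.mul_re, Complex.I_re, Complex.I_im]
    rw [show 16 * ((1 + D) / δ) * s = 2 * (8 * ((1 + D) / δ) * s) by ring]
    generalize 8 * ((1 + D) / δ) * s = w
    ring
  simp_rw [e]
  refine (lintegral_mono fun x => EE_half _ _).trans ?_
  rw [lintegral_const_mul _ (by fun_prop), lintegral_add_left (by fun_prop)]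
  calc _ ≤ 2⁻¹ * (KG + KG) := by gcongr
    _ = KG := by
      rw [← two_mul, ← mul_assoc, ENNReal.inv_mul_cancel (by norm_num) (by norm_num), one_mul]

lemma EE_jensen {κ : Type*} (s : Finset κ) (p y : κ → ℝ) (hp : ∀ k ∈ s, 0 ≤ p k)
    (h1 : ∑ k ∈ s, p k = 1) :
    EE (∑ k ∈ s, p k * y k) ≤ ∑ k ∈ s, ENNReal.ofReal (p k) * EE (y k) := by
  have h := convexOn_exp.map_sum_le hp h1 (fun i _ => Set.mem_univ (y i))
  simp only [smul_eq_mul] at h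
  unfold EE
  refine (ENNReal.ofReal_le_ofReal h).trans (le_of_eq ?_)
  rw [ENNReal.ofReal_sum_of_nonneg (fun k hk => mul_nonneg (hp k hk) (Real.exp_pos _).le)]
  exact Finset.sum_congr rfl fun k hk => ENNReal.ofReal_mul (hp k hk)

lemma sq_forms {κ : Type*} [Fintype κ] (hμ : ∀ i, SG δ D (μ i)) (b : κ → ι → ℂ) (S : ℝ)
    (_ : 0 < S)
    (hS : ∑ k, ∑ j, ‖b k j‖ ^ 2 ≤ S) (hB : 0 < (1 + D) / δ) :
    ∫⁻ x, EE ((∑ k, ‖∑ j, b k j * x j‖ ^ 2) / (16 * ((1 + D) / δ) * S)) ∂(Measure.pi μ) ≤ KG := by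
  have := fun i => (hμ i).prob
  set B := (1 + D) / δ
  set s : κ → ℝ := fun k => ∑ j, ‖b k j‖ ^ 2 with hs
  have hsn : ∀ k, 0 ≤ s k := fun k => Finset.sum_nonneg fun i _ => by positivity
  set S' := ∑ k, s k with hS'
  have hX0 : ∀ k, s k = 0 → ∀ x : ι → ℂ, ∑ j, b k j * x j = 0 := by
    intro k hk x
    refine Finset.sum_eq_zero fun j _ => ?_
    have := (Finset.sum_eq_zero_iff_of_nonneg (fun j _ => by positivity)).1 hk j (Finset.mem_univ _)
    have : b k j = 0 := by simpa using this
    rw [this, zero_mul]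
  have hSn : 0 ≤ S' := Finset.sum_nonneg fun i _ => hsn i
  rcases hSn.eq_or_lt with h0 | h0
  · have hz : ∀ k, s k = 0 := fun k =>
      (Finset.sum_eq_zero_iff_of_nonneg (fun j _ => hsn j)).1 h0.symm k (Finset.mem_univ _)
    have : ∀ x : ι → ℂ, ∀ k, ∑ j, b k j * x j = 0 := fun x k => hX0 k (hz k) x
    simp only [this]
    simpa [EE_zero] using one_le_KG
  have hle : ∀ x : ι → ℂ, EE ((∑ k, ‖∑ j, b k j * x j‖ ^ 2) / (16 * B * S)) ≤
      ∑ k, ENNReal.ofReal (s k / S') * EE (‖∑ j, b k j * x j‖ ^ 2 / (16 * B * s k)) := by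
    intro x
    refine le_trans (EE_mono ?_) (EE_jensen Finset.univ (fun k => s k / S')
      (fun k => ‖∑ j, b k j * x j‖ ^ 2 / (16 * B * s k)) (fun k _ => by have := hsn k; positivity) (by
        rw [← Finset.sum_div]; exact div_self h0.ne'))
    calc _ ≤ (∑ k, ‖∑ j, b k j * x j‖ ^ 2) / (16 * B * S') := by gcongr
      _ = _ := by
        rw [Finset.sum_div]
        refine Finset.sum_congr rfl fun k _ => ?_
        by_cases hk : s k = 0
        · rw [hX0 k hk x, hk]; simp
        · field_simp
  refine (lintegral_mono hle).trans ?_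
  rw [lintegral_finsetSum _ (fun k _ => by fun_prop)]
  calc _ ≤ ∑ k, ENNReal.ofReal (s k / S') * KG := by
        refine Finset.sum_le_sum fun k _ => ?_
        rw [lintegral_const_mul _ (by fun_prop)]
        gcongr
        exact sq_form hμ (b k) (s k) rfl hB
    _ = KG := by
        rw [← Finset.sum_mul, ← ENNReal.ofReal_sum_of_nonneg (fun k _ => by have := hsn k; positivity),
          ← Finset.sum_div, div_self h0.ne']
        simp

lemma bilin {κ : Type*} [Fintype κ] {μ' : κ → Measure ℂ} (hμ : ∀ i, SG δ D (μ i))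
    (hμ' : ∀ i, SG δ D (μ' i)) (A : ι → κ → ℂ) (hB : 0 < (1 + D) / δ)
    (hA : ∑ j, ∑ k, ‖A j k‖ ^ 2 ≤ 1 / (16 * ((1 + D) / δ) ^ 2)) :
    ∫⁻ x, ∫⁻ y, EE (∑ j, ∑ k, (starRingEnd ℂ) (x j) * A j k * y k).re
      ∂(Measure.pi μ') ∂(Measure.pi μ) ≤ KG := by
  have := fun i => (hμ i).prob
  have := fun i => (hμ' i).prob
  set B := (1 + D) / δ
  have h1 : ∀ x : ι → ℂ, ∫⁻ y, EE (∑ j, ∑ k, (starRingEnd ℂ) (x j) * A j k * y k).re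
      ∂(Measure.pi μ') ≤ 
      EE ((∑ k, ‖∑ j, (starRingEnd ℂ) (A j k) * x j‖ ^ 2) / (16 * B * (1 / (16 * B ^ 2)))) := by
    intro x
    have e : ∀ y : κ → ℂ, (∑ j, ∑ k, (starRingEnd ℂ) (x j) * A j k * y k) =
       ∑ k, (∑ j, (starRingEnd ℂ) (x j) * A j k) * y k := by
      intro y; rw [Finset.sum_comm]; simp_rw [Finset.sum_mul]
    simp_rw [e]
    refine (lin_form hμ' _).trans (EE_mono (le_of_eq ?_))
    change B * _ = _
    have : 16 * B * (1 / (16 * B ^ 2)) = 1 / B := by field_simp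
    rw [this, div_div_eq_mul_div, div_one, mul_comm]
    congr 1
    refine Finset.sum_congr rfl fun k _ => ?_
    rw [← Complex.norm_conj, map_sum]
    simp [mul_comm]
  refine (lintegral_mono h1).trans ?_
  refine sq_forms hμ (fun k j => (starRingEnd ℂ) (A j k)) _ (by positivity) ?_ hB
  rw [Finset.sum_comm]
  simpa using hA

end forms


section HW
variable {ι : Type*} [Fintype ι] [DecidableEq ι] {δ D : ℝ} {μ : ι → Measure ℂ}

lemma card_split (j k : ι) (hjk : j ≠ k) :
    (((Finset.univ : Finset (ι → Bool)).filter (fun f => f j = true ∧ f k = false)).card : ℝ) * 4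
      = 2 ^ Fintype.card ι := by
  have e : (Finset.univ : Finset (ι → Bool)).filter (fun f => f j = true ∧ f k = false) =
      Fintype.piFinset (fun i => if i = j then {true} else if i = k then {false} else
        (Finset.univ : Finset Bool)) := by
    ext f
    simp only [Finset.mem_filter, Finset.mem_univ, true_and, Fintype.mem_piFinset]
    constructor
    · rintro ⟨h1, h2⟩ i
      by_cases hi : i = j
      · simp [hi, h1]
      · by_cases hk : i = k
        · simp [hk, h2, hjk.symm]
        · simp [hi, hk]
    · intro h
      have h1 := h j
      have h2 := h k
      simp [hjk.symm] at h1 h2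
      exact ⟨h1, h2⟩
  rw [e, Fintype.card_piFinset]
  have h3 : ∀ i, (if i = j then {true} else if i = k then {false} else
        (Finset.univ : Finset Bool)).card = if i = j then 1 else if i = k then 1 else 2 := by
    intro i; split_ifs <;> simp
  simp_rw [h3]
  rw [← Finset.mul_prod_erase Finset.univ _ (Finset.mem_univ j),
    ← Finset.mul_prod_erase (Finset.univ.erase j) _ (Finset.mem_erase.2 ⟨hjk.symm, Finset.mem_univ k⟩)]
  rw [Finset.prod_congr rfl (g := fun _ => 2) (fun i hi => by
    simp only [Finset.mem_erase] at hi
    simp [hi.1, hi.2.1])]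
  simp only [Finset.prod_const]
  have hc : ((Finset.univ.erase j).erase k).card + 2 = Fintype.card ι := by
    have h1 := Finset.card_erase_add_one (Finset.mem_univ j)
    have h2 := Finset.card_erase_add_one (Finset.mem_erase.2 ⟨hjk.symm, Finset.mem_univ k⟩)
    rw [Finset.card_univ] at h1
    omega
  rw [← hc, pow_add]
  simp [hjk.symm]
  norm_num

lemma decouple_id (t : ι → ι → ℂ) :
    (∑ j, ∑ k, if j = k then 0 else t j k) =
     ∑ f : ι → Bool, ((1 / 2 ^ Fintype.card ι : ℝ) : ℂ) *
      ∑ j, ∑ k, if f j = true ∧ f k = false then 4 * t j k else 0 := by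
  rw [← Finset.mul_sum (s := (Finset.univ : Finset (ι → Bool))),
    Finset.sum_comm (s := (Finset.univ : Finset (ι → Bool))),
    Finset.mul_sum (s := (Finset.univ : Finset ι))]
  refine Finset.sum_congr rfl fun j _ => ?_
  rw [Finset.sum_comm (s := (Finset.univ : Finset (ι → Bool))),
    Finset.mul_sum (s := (Finset.univ : Finset ι))]
  refine Finset.sum_congr rfl fun k _ => ?_
  rw [← Finset.sum_filter, Finset.sum_const, nsmul_eq_mul]
  split_ifs with h
  · have : (Finset.univ : Finset (ι → Bool)).filter (fun f => f j = true ∧ f k = false) = ∅ := by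
      ext f; subst h; simp
    rw [this]; simp
  · have := congrArg (fun x : ℝ => (x : ℂ)) (card_split j k h)
    push_cast at this ⊢
    have h2 : (2 : ℂ) ^ Fintype.card ι ≠ 0 := pow_ne_zero _ two_ne_zero
    field_simp
    rw [← this]; ring

lemma decouple_one (hμ : ∀ i, SG δ D (μ i)) (A : ι → ι → ℂ) (hB : 0 < (1 + D) / δ)
    (hA : ∑ j, ∑ k, ‖A j k‖ ^ 2 ≤ 1 / (16 * ((1 + D) / δ) ^ 2)) (f : ι → Bool) :
    ∫⁻ z, EE (∑ j, ∑ k, if f j = true ∧ f k = false then 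
      (starRingEnd ℂ) (z j) * A j k * z k else 0).re ∂(Measure.pi μ) ≤ KG := by
  have := fun i => (hμ i).prob
  let p : ι → Prop := fun i => f i = true
  have mp := measurePreserving_piEquivPiSubtypeProd (α := fun _ => ℂ) μ p
  let F : ({i // p i} → ℂ) × ({i // ¬ p i} → ℂ) → ℝ≥0∞ := fun w =>
    EE (∑ j : {i // p i}, ∑ k : {i // ¬ p i}, (starRingEnd ℂ) (w.1 j) * A j k * w.2 k).re
  have hF : Measurable F := by
    apply measurable_EE.comp
    apply Complex.measurable_re.comp
    refine Finset.measurable_sum _ fun (j : {i // p i}) _ =>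
      Finset.measurable_sum _ fun (k : {i // ¬ p i}) _ => ?_
    have h1 : Measurable fun w : ({i // p i} → ℂ) × ({i // ¬ p i} → ℂ) => w.1 j :=
      (measurable_pi_apply j).comp measurable_fst
    have h2 : Measurable fun w : ({i // p i} → ℂ) × ({i // ¬ p i} → ℂ) => w.2 k :=
      (measurable_pi_apply k).comp measurable_snd
    exact ((Complex.continuous_conj.measurable.comp h1).mul_const _).mul h2
  have e : ∀ z : ι → ℂ, EE (∑ j, ∑ k, if f j = true ∧ f k = false then 
      (starRingEnd ℂ) (z j) * A j k * z k else 0).re =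
      F (MeasurableEquiv.piEquivPiSubtypeProd (fun _ => ℂ) p z) := by
    intro z
    simp only [F]
    congr 2
    rw [← Fintype.sum_subtype_add_sum_subtype p]
    have h0 : ∑ j : {i // ¬ p i}, (∑ k, if f j = true ∧ f k = false then 
      (starRingEnd ℂ) (z j) * A j k * z k else 0) = 0 := by
      refine Finset.sum_eq_zero fun j _ => Finset.sum_eq_zero fun k _ => ?_
      rw [if_neg]; rintro ⟨h, -⟩; exact j.2 h
    rw [h0, add_zero]
    refine Finset.sum_congr rfl fun j _ => ?_
    rw [← Fintype.sum_subtype_add_sum_subtype p]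
    have h1 : ∑ k : {i // p i}, (if f j = true ∧ f k = false then 
      (starRingEnd ℂ) (z j) * A j k * z k else 0) = 0 := by
      refine Finset.sum_eq_zero fun k _ => ?_
      rw [if_neg]; rintro ⟨-, h⟩; have := k.2; simp [p, h] at this
    rw [h1, zero_add]
    refine Finset.sum_congr rfl fun k _ => ?_
    rw [if_pos ⟨j.2, by have := k.2; simpa [p] using this⟩]
    rfl
  simp_rw [e]
  rw [mp.lintegral_comp hF, lintegral_prod _ hF.aemeasurable]
  refine bilin (μ := fun i : {i // p i} => μ i) (μ' := fun i : {i // ¬ p i} => μ i)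
    (fun i => hμ i) (fun i => hμ i) (fun (j : {i // p i}) (k : {i // ¬ p i}) => A j k) hB ?_
  refine le_trans ?_ hA
  rw [← Fintype.sum_subtype_add_sum_subtype p (fun j => ∑ k, ‖A j k‖ ^ 2)]
  refine le_trans ?_ (le_add_of_nonneg_right (Finset.sum_nonneg fun j _ =>
    Finset.sum_nonneg fun k _ => by positivity))
  refine Finset.sum_le_sum fun j _ => ?_
  rw [← Fintype.sum_subtype_add_sum_subtype p (fun k => ‖A j k‖ ^ 2)]
  exact le_add_of_nonneg_left (Finset.sum_nonneg fun k _ => by positivity)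

lemma offdiag (hμ : ∀ i, SG δ D (μ i)) (A : ι → ι → ℂ) (hB : 0 < (1 + D) / δ)
    (hA : ∑ j, ∑ k, ‖A j k‖ ^ 2 ≤ 1 / (256 * ((1 + D) / δ) ^ 2)) :
    ∫⁻ z, EE (∑ j, ∑ k, if j = k then 0 else 
      (starRingEnd ℂ) (z j) * A j k * z k).re ∂(Measure.pi μ) ≤ KG := by
  have := fun i => (hμ i).prob
  set n := Fintype.card ι
  have hle : ∀ z : ι → ℂ, EE (∑ j, ∑ k, if j = k then 0 else 
      (starRingEnd ℂ) (z j) * A j k * z k).re ≤ 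
      ∑ f : ι → Bool, ENNReal.ofReal (1 / 2 ^ n) *
      EE (∑ j, ∑ k, if f j = true ∧ f k = false then 
        (starRingEnd ℂ) (z j) * (4 * A j k) * z k else 0).re := by
    intro z
    rw [decouple_id, Complex.re_sum]
    simp_rw [Complex.re_ofReal_mul]
    refine (EE_jensen _ _ _ (fun _ _ => by positivity) ?_).trans (le_of_eq ?_)
    · simp
    · refine Finset.sum_congr rfl fun f _ => ?_
      congr 3
      refine Finset.sum_congr rfl fun j _ => Finset.sum_congr rfl fun k _ => ?_
      split_ifs <;> ring
  refine (lintegral_mono hle).trans ?_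
  have hm : ∀ f : ι → Bool, Measurable fun z : ι → ℂ => 
      EE (∑ j, ∑ k, if f j = true ∧ f k = false then 
        (starRingEnd ℂ) (z j) * (4 * A j k) * z k else 0).re := by
    intro f
    apply measurable_EE.comp
    apply Complex.measurable_re.comp
    refine Finset.measurable_sum _ fun j _ => Finset.measurable_sum _ fun k _ => ?_
    split_ifs
    · exact ((Complex.continuous_conj.measurable.comp (measurable_pi_apply j)).mul_const _).mul 
        (measurable_pi_apply k)
    · exact measurable_const
  rw [lintegral_finsetSum _ (fun f _ => (hm f).const_mul _)]
  calc _ ≤ ∑ f : ι → Bool, ENNReal.ofReal (1 / 2 ^ n) * KG := by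
        refine Finset.sum_le_sum fun f _ => ?_
        rw [lintegral_const_mul _ (hm f)]
        gcongr
        refine decouple_one hμ (fun j k => 4 * A j k) hB ?_ f
        have : ∀ j k, ‖4 * A j k‖ ^ 2 = 16 * ‖A j k‖ ^ 2 := by
          intro j k; rw [norm_mul, mul_pow]; norm_num
        simp_rw [this, ← Finset.mul_sum]
        calc _ ≤ 16 * (1 / (256 * ((1 + D) / δ) ^ 2)) := by gcongr
          _ = _ := by field_simp; norm_num
    _ = KG := by
        rw [← Finset.sum_mul, ← ENNReal.ofReal_sum_of_nonneg (fun k _ => by positivity)]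
        simp [n]

lemma diagpart (hμ : ∀ i, SG δ D (μ i)) (a : ι → ℝ) (hδ : 0 < δ) (hD : 0 ≤ D)
    (hA : ∑ j, a j ^ 2 ≤ (δ / 2) ^ 2) :
    ∫⁻ z, EE (∑ j, a j * (‖z j‖ ^ 2 - 1)) ∂(Measure.pi μ) ≤ EE (2 * Real.exp δ * D) := by
  have := fun i => (hμ i).prob
  simp_rw [EE_sum]
  rw [lintegral_pi_prod μ (fun j z => EE (a j * (‖z‖ ^ 2 - 1))) (fun j => by fun_prop)]
  calc _ ≤ ∏ j, EE (8 * Real.exp δ * D / δ ^ 2 * a j ^ 2) := by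
        refine Finset.prod_le_prod' fun j _ => (hμ j).quad (a j) ?_
        refine abs_le_of_sq_le_sq ?_ (by positivity)
        exact (Finset.single_le_sum (f := fun j => a j ^ 2) (fun j _ => sq_nonneg _)
          (Finset.mem_univ j)).trans hA
    _ ≤ _ := by
        rw [← EE_sum, ← Finset.mul_sum]
        apply EE_mono
        calc _ ≤ 8 * Real.exp δ * D / δ ^ 2 * (δ / 2) ^ 2 := by gcongr
          _ = _ := by field_simp; ring

/-- centred quadratic form -/
def QF (A : ι → ι → ℂ) (z : ι → ℂ) : ℂ :=
  (∑ j, ∑ k, (starRingEnd ℂ) (z j) * A j k * z k) - ∑ j, A j j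


lemma QF_smul (c : ℂ) (A : ι → ι → ℂ) (z : ι → ℂ) : QF (fun j k => c * A j k) z = c * QF A z := by
  unfold QF
  rw [mul_sub, Finset.mul_sum, Finset.mul_sum]
  congr 1
  refine Finset.sum_congr rfl fun j _ => ?_
  rw [Finset.mul_sum]
  exact Finset.sum_congr rfl fun k _ => by ring

lemma QF_eq (A : ι → ι → ℂ) (z : ι → ℂ) : (QF A z).re =
    (∑ j, ∑ k, if j = k then 0 else (starRingEnd ℂ) (z j) * A j k * z k).re +
    ∑ j, (A j j).re * (‖z j‖ ^ 2 - 1) := by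
  have h : QF A z = (∑ j, ∑ k, if j = k then 0 else (starRingEnd ℂ) (z j) * A j k * z k) +
      ∑ j, A j j * ((‖z j‖ ^ 2 - 1 : ℝ) : ℂ) := by
    unfold QF
    rw [← Finset.sum_add_distrib, ← Finset.sum_sub_distrib]
    refine Finset.sum_congr rfl fun j _ => ?_
    rw [← Finset.add_sum_erase _ _ (Finset.mem_univ j), ← Finset.add_sum_erase _ (fun k => 
      if j = k then 0 else (starRingEnd ℂ) (z j) * A j k * z k) (Finset.mem_univ j)]
    rw [Finset.sum_congr (s₁ := Finset.univ.erase j) rfl (f := fun k =>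
      if j = k then 0 else (starRingEnd ℂ) (z j) * A j k * z k)
      (g := fun k => (starRingEnd ℂ) (z j) * A j k * z k) (fun k hk => by
      rw [if_neg (Finset.ne_of_mem_erase hk).symm])]
    have : (starRingEnd ℂ) (z j) * z j = ((‖z j‖ ^ 2 : ℝ) : ℂ) := by
      rw [mul_comm, Complex.mul_conj, Complex.normSq_eq_norm_sq]
    rw [if_pos rfl, mul_right_comm, this]
    push_cast; ring
  rw [h, Complex.add_re, Complex.re_sum (s := Finset.univ) (f := fun j => A j j * _)]
  congr 1
  refine Finset.sum_congr rfl fun j _ => ?_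
  rw [mul_comm, Complex.re_ofReal_mul, mul_comm]

lemma measurable_QF (A : ι → ι → ℂ) : Measurable (QF A) := by
  unfold QF
  refine Measurable.sub_const (Finset.measurable_sum _ fun j _ => Finset.measurable_sum _ fun k _ => ?_) _
  exact ((Complex.continuous_conj.measurable.comp (measurable_pi_apply j)).mul_const _).mul 
        (measurable_pi_apply k)

lemma EE_max (x y : ℝ) : EE (x + y) ≤ EE (2 * x) + EE (2 * y) := by
  rcases le_total x y with h | h
  · exact (EE_mono (by linarith)).trans le_add_self
  · exact (EE_mono (by linarith)).trans le_self_add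

lemma QF_re (hμ : ∀ i, SG δ D (μ i)) (A : ι → ι → ℂ) (hδ : 0 < δ) (hD : 1 ≤ D)
    (hA1 : ∑ j, ∑ k, ‖2 * A j k‖ ^ 2 ≤ 1 / (256 * ((1 + D) / δ) ^ 2))
    (hA2 : ∑ j, ∑ k, ‖2 * A j k‖ ^ 2 ≤ (δ / 2) ^ 2) :
    ∫⁻ z, EE (QF A z).re ∂(Measure.pi μ) ≤ KG + EE (2 * Real.exp δ * D) := by
  have := fun i => (hμ i).prob
  have hB : 0 < (1 + D) / δ := by positivity
  have h1 := offdiag hμ (fun j k => 2 * A j k) hB hA1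
  have h2 := diagpart hμ (fun j => (2 * A j j).re) hδ (by linarith) (by
    refine le_trans (Finset.sum_le_sum fun j _ => ?_) hA2
    calc (2 * A j j).re ^ 2 ≤ ‖2 * A j j‖ ^ 2 :=
          sq_le_sq' (by linarith [(abs_le.1 (Complex.abs_re_le_norm (2 * A j j))).1]) 
            (Complex.re_le_norm _)
      _ ≤ _ := Finset.single_le_sum (f := fun k => ‖2 * A j k‖ ^ 2) (fun k _ => by positivity)
          (Finset.mem_univ j))
  refine le_trans ?_ (add_le_add h1 h2)
  have hm : Measurable fun z : ι → ℂ => EE (∑ j, (2 * A j j).re * (‖z j‖ ^ 2 - 1)) := by fun_prop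
  rw [← lintegral_add_right _ hm]
  refine lintegral_mono fun z => ?_
  simp only
  rw [QF_eq]
  refine (EE_max _ _).trans (le_of_eq ?_)
  congr 2
  · have : (2 : ℝ) * (∑ j, ∑ k, if j = k then 0 else (starRingEnd ℂ) (z j) * A j k * z k).re =
      (((2 : ℝ) : ℂ) * (∑ j, ∑ k, if j = k then 0 else (starRingEnd ℂ) (z j) * A j k * z k)).re := by
      rw [Complex.re_ofReal_mul]
    rw [this, Finset.mul_sum]
    congr 1
    refine Finset.sum_congr rfl fun j _ => ?_
    rw [Finset.mul_sum]
    refine Finset.sum_congr rfl fun k _ => ?_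
    split_ifs <;> push_cast <;> ring
  · rw [Finset.mul_sum]
    refine Finset.sum_congr rfl fun j _ => ?_
    have : (2 * A j j).re = 2 * (A j j).re := by simp
    rw [this]; ring

lemma EE_norm (w : ℂ) : EE ‖w‖ ≤ EE (2 * w).re + EE (-2 * w).re +
    (EE (2 * Complex.I * w).re + EE (-2 * Complex.I * w).re) := by
  refine (EE_mono (Complex.norm_le_abs_re_add_abs_im w)).trans ((EE_max _ _).trans ?_)
  simp only [Complex.mul_re, Complex.mul_im, Complex.neg_re, Complex.neg_im, Complex.re_ofNat,
    Complex.im_ofNat, Complex.I_re, Complex.I_im]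
  refine add_le_add ?_ ?_
  · rcases abs_cases w.re with ⟨h, _⟩ | ⟨h, _⟩ <;> rw [h]
    · exact (EE_mono (by linarith)).trans le_self_add
    · exact (EE_mono (by linarith)).trans le_add_self
  · rcases abs_cases w.im with ⟨h, _⟩ | ⟨h, _⟩ <;> rw [h]
    · exact (EE_mono (by linarith)).trans le_add_self
    · exact (EE_mono (by linarith)).trans le_self_add

/-- Hanson--Wright type bound. -/
lemma HW_exp (hμ : ∀ i, SG δ D (μ i)) (A : ι → ι → ℂ) (hδ : 0 < δ) (hD : 1 ≤ D)
    (hA1 : ∑ j, ∑ k, ‖A j k‖ ^ 2 ≤ 1 / (16 * (256 * ((1 + D) / δ) ^ 2)))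
    (hA2 : ∑ j, ∑ k, ‖A j k‖ ^ 2 ≤ (δ / 2) ^ 2 / 16) :
    ∫⁻ z, EE ‖QF A z‖ ∂(Measure.pi μ) ≤ 4 * (KG + EE (2 * Real.exp δ * D)) := by
  have key : ∀ c : ℂ, ‖c‖ = 2 → ∫⁻ z, EE (c * QF A z).re ∂(Measure.pi μ) ≤
      KG + EE (2 * Real.exp δ * D) := by
    intro c hc
    simp_rw [← QF_smul]
    have e : ∑ j, ∑ k, ‖2 * (c * A j k)‖ ^ 2 = 16 * ∑ j, ∑ k, ‖A j k‖ ^ 2 := by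
      simp_rw [Finset.mul_sum, norm_mul, hc]
      refine Finset.sum_congr rfl fun j _ => Finset.sum_congr rfl fun k _ => ?_
      norm_num; ring
    apply QF_re hμ _ hδ hD <;> rw [e]
    · calc _ ≤ 16 * (1 / (16 * (256 * ((1 + D) / δ) ^ 2))) := by gcongr
        _ = _ := by field_simp
    · linarith
  have hm : ∀ c : ℂ, Measurable fun z => EE (c * QF A z).re := fun c =>
    measurable_EE.comp (Complex.measurable_re.comp ((measurable_QF A).const_mul c))
  refine (lintegral_mono fun z => EE_norm _).trans ?_
  have hm2 : Measurable fun z => EE (2 * QF A z).re + EE (-2 * QF A z).re := (hm _).add (hm _)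
  rw [lintegral_add_left hm2, lintegral_add_left (hm _), lintegral_add_left (hm _)]
  calc _ ≤ (KG + EE (2 * Real.exp δ * D)) + (KG + EE (2 * Real.exp δ * D)) +
      ((KG + EE (2 * Real.exp δ * D)) + (KG + EE (2 * Real.exp δ * D))) := by
        gcongr <;> exact key _ (by simp)
    _ = _ := by ring

/-- Tail form. -/
lemma HW_tail (δ D : ℝ) (hδ : 0 < δ) (hD : 1 ≤ D) : ∃ τ K : ℝ, 0 < τ ∧ 0 < K ∧
    ∀ (ι : Type) (_ : Fintype ι) (_ : DecidableEq ι) (μ : ι → Measure ℂ),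
    (∀ i, SG δ D (μ i)) → ∀ (A : ι → ι → ℂ) (σ ε : ℝ), 0 < σ → ∑ j, ∑ k, ‖A j k‖ ^ 2 ≤ σ ^ 2 →
     Measure.pi μ {z | ε ≤ ‖QF A z‖} ≤ ENNReal.ofReal (K * Real.exp (-(τ * ε / σ))) := by
  set m := min (1 / (16 * (256 * ((1 + D) / δ) ^ 2))) ((δ / 2) ^ 2 / 16) with hm
  have hm0 : 0 < m := by apply lt_min <;> positivity
  set K0 := 4 * (KG + EE (2 * Real.exp δ * D)) with hK0
  have hK0t : K0 ≠ ⊤ := ENNReal.mul_ne_top (by norm_num)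
    (ENNReal.add_ne_top.2 ⟨KG_lt_top.ne, EE_ne_top _⟩)
  refine ⟨√m, K0.toReal, Real.sqrt_pos.2 hm0, ENNReal.toReal_pos ?_ hK0t, ?_⟩
  · rw [hK0]
    have := one_le_KG
    have h1 : (0 : ℝ≥0∞) < KG := lt_of_lt_of_le one_pos this
    positivity
  intro ι _ _ μ hμ A σ ε hσ hA
  set θ := √m / σ with hθ
  have hθ0 : 0 < θ := by have := Real.sqrt_pos.2 hm0; positivity
  have hAθ : ∑ j, ∑ k, ‖(θ : ℂ) * A j k‖ ^ 2 ≤ m := by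
    have e : ∑ j, ∑ k, ‖(θ : ℂ) * A j k‖ ^ 2 = θ ^ 2 * ∑ j, ∑ k, ‖A j k‖ ^ 2 := by
      simp_rw [Finset.mul_sum, norm_mul, Complex.norm_real, Real.norm_of_nonneg hθ0.le, mul_pow]
    rw [e]
    calc _ ≤ θ ^ 2 * σ ^ 2 := by gcongr
      _ = m := by rw [hθ, div_pow, Real.sq_sqrt hm0.le]; field_simp
  have h := HW_exp hμ _ hδ hD (hAθ.trans (min_le_left _ _)) (hAθ.trans (min_le_right _ _))
  have hmeas : Measurable fun z => EE ‖QF (fun j k => (θ : ℂ) * A j k) z‖ :=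
    measurable_EE.comp (measurable_norm.comp (measurable_QF _))
  have hmk := meas_ge_le_lintegral_div (μ := Measure.pi μ) hmeas.aemeasurable (ε := EE (θ * ε))
    (by simp [EE, Real.exp_pos]) (EE_ne_top _)
  calc _ ≤ Measure.pi μ {z | EE (θ * ε) ≤ EE ‖QF (fun j k => (θ : ℂ) * A j k) z‖} := by
        apply measure_mono
        intro z hz
        apply EE_mono
        rw [QF_smul, norm_mul, Complex.norm_real, Real.norm_of_nonneg hθ0.le]
        exact mul_le_mul_of_nonneg_left hz hθ0.le
    _ ≤ _ := hmk
    _ ≤ K0 / EE (θ * ε) := by gcongr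
    _ = _ := by
        rw [ENNReal.ofReal_mul ENNReal.toReal_nonneg, ENNReal.ofReal_toReal hK0t, Real.exp_neg,
          ENNReal.ofReal_inv_of_pos (Real.exp_pos _), div_eq_mul_inv, EE, hθ]
        congr 4
        ring
end HW


section DetPart
set_option linter.all false
open Matrix

/-- The resolvent. -/
def res {n : Type} [Fintype n] [DecidableEq n] (H : Matrix n n ℂ) (z : ℂ) : Matrix n n ℂ :=
  (H - z • (1 : Matrix n n ℂ))⁻¹

variable {n : Type} [Fintype n] [DecidableEq n] {H : Matrix n n ℂ} {z : ℂ}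

theorem res_isUnit (hH : H.IsHermitian) (hz : 0 < z.im) :
    IsUnit (H - z • (1 : Matrix n n ℂ)).det := by
  rw [isUnit_iff_ne_zero]
  intro h0
  obtain ⟨v, hv, hv0⟩ := Matrix.exists_mulVec_eq_zero_iff.mpr h0
  have h1 : H *ᵥ v = z • v := by
    rw [Matrix.sub_mulVec, Matrix.smul_mulVec, Matrix.one_mulVec] at hv0
    exact sub_eq_zero.mp hv0
  have h2 : (star v ⬝ᵥ H *ᵥ v).im = 0 := by
    exact hH.im_star_dotProduct_mulVec_self v
  rw [h1, dotProduct_smul] at h2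
  have h3 : star v ⬝ᵥ v = ((∑ i, ‖v i‖ ^ 2 : ℝ) : ℂ) := by
    simp only [dotProduct, Pi.star_apply, Complex.ofReal_sum]
    refine Finset.sum_congr rfl fun i _ => ?_
    have := Complex.conj_mul' (v i)
    simpa using this
  rw [h3, smul_eq_mul, Complex.im_mul_ofReal] at h2
  have h4 : (0:ℝ) < ∑ i, ‖v i‖ ^ 2 := by
    obtain ⟨i, hi⟩ := Function.ne_iff.mp hv
    refine Finset.sum_pos' (fun _ _ => by positivity) ⟨i, Finset.mem_univ _, ?_⟩
    have : 0 < ‖v i‖ := norm_pos_iff.mpr hi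
    positivity
  have := mul_pos hz h4
  linarith

theorem res_mul (hH : H.IsHermitian) (hz : 0 < z.im) :
    (H - z • (1 : Matrix n n ℂ)) * res H z = 1 := Matrix.mul_nonsing_inv _ (res_isUnit hH hz)

theorem mul_res (hH : H.IsHermitian) (hz : 0 < z.im) :
    res H z * (H - z • (1 : Matrix n n ℂ)) = 1 := Matrix.nonsing_inv_mul _ (res_isUnit hH hz)

theorem adj_sub (hH : H.IsHermitian) :
    (H - z • (1 : Matrix n n ℂ))ᴴ = (H - z • (1 : Matrix n n ℂ)) + (2 * z.im * Complex.I) • (1 : Matrix n n ℂ) := by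
  rw [Matrix.conjTranspose_sub, hH.eq, Matrix.conjTranspose_smul, Matrix.conjTranspose_one,
    sub_add, ← sub_smul]
  congr 2
  apply Complex.ext <;> simp <;> ring

theorem ward_row (hH : H.IsHermitian) (hz : 0 < z.im) (i : n) :
    z.im * ∑ j, ‖res H z i j‖ ^ 2 = (res H z i i).im := by
  have h1 := mul_res hH hz
  have h2 : (H - z • (1 : Matrix n n ℂ))ᴴ * (res H z)ᴴ = 1 := by
    rw [← Matrix.conjTranspose_mul, h1, Matrix.conjTranspose_one]
  have h3 : res H z = (res H z)ᴴ + (2 * z.im * Complex.I) • (res H z * (res H z)ᴴ) := by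
    calc res H z = res H z * ((H - z • (1 : Matrix n n ℂ))ᴴ * (res H z)ᴴ) := by rw [h2, Matrix.mul_one]
      _ = _ := by
        rw [adj_sub hH, Matrix.add_mul, Matrix.mul_add, ← Matrix.mul_assoc, h1, Matrix.one_mul]
        simp
  have h4 := congrArg Complex.im (congrFun (congrFun h3 i) i)
  have h5 : (res H z * (res H z)ᴴ) i i = ((∑ j, ‖res H z i j‖ ^ 2 : ℝ) : ℂ) := by
    simp only [Matrix.mul_apply, Complex.ofReal_sum]
    refine Finset.sum_congr rfl fun j _ => ?_
    have := Complex.mul_conj' (res H z i j)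
    simpa using this
  rw [Matrix.add_apply, Matrix.smul_apply, h5, smul_eq_mul, Complex.add_im, Complex.im_mul_ofReal] at h4
  simp at h4
  nlinarith [h4]

theorem ward_col (hH : H.IsHermitian) (hz : 0 < z.im) (i : n) :
    z.im * ∑ j, ‖res H z j i‖ ^ 2 = (res H z i i).im := by
  have h1 := res_mul hH hz
  have h2 : (res H z)ᴴ * (H - z • (1 : Matrix n n ℂ))ᴴ = 1 := by
    rw [← Matrix.conjTranspose_mul, h1, Matrix.conjTranspose_one]
  have h3 : res H z = (res H z)ᴴ + (2 * z.im * Complex.I) • ((res H z)ᴴ * (res H z)) := by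
    calc res H z = ((res H z)ᴴ * (H - z • (1 : Matrix n n ℂ))ᴴ) * res H z := by rw [h2, Matrix.one_mul]
      _ = _ := by
        rw [adj_sub hH, Matrix.mul_add, Matrix.add_mul, Matrix.mul_assoc, h1, Matrix.mul_one]
        simp
  have h4 := congrArg Complex.im (congrFun (congrFun h3 i) i)
  have h5 : ((res H z)ᴴ * (res H z)) i i = ((∑ j, ‖res H z j i‖ ^ 2 : ℝ) : ℂ) := by
    simp only [Matrix.mul_apply, Complex.ofReal_sum]
    refine Finset.sum_congr rfl fun j _ => ?_
    have := Complex.conj_mul' (res H z j i)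
    simpa using this
  rw [Matrix.add_apply, Matrix.smul_apply, h5, smul_eq_mul, Complex.add_im, Complex.im_mul_ofReal] at h4
  simp at h4
  nlinarith [h4]

theorem sum_mul_sq_le (a b : n → ℂ) : ‖∑ j, a j * b j‖ ^ 2 ≤ (∑ j, ‖a j‖ ^ 2) * ∑ j, ‖b j‖ ^ 2 := by
  calc ‖∑ j, a j * b j‖ ^ 2 ≤ (∑ j, ‖a j‖ * ‖b j‖) ^ 2 := by
        gcongr
        exact (norm_sum_le _ _).trans (le_of_eq (by simp))
    _ ≤ _ := Finset.sum_mul_sq_le_sq_mul_sq _ _ _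

theorem res_im_nonneg (hH : H.IsHermitian) (hz : 0 < z.im) (i : n) : 0 ≤ (res H z i i).im := by
  rw [← ward_row hH hz i]; positivity

theorem res_ne_zero (hH : H.IsHermitian) (hz : 0 < z.im) (i : n) : res H z i i ≠ 0 := by
  intro h0
  have h := ward_row hH hz i
  rw [h0] at h
  have h1 : ∑ j, ‖res H z i j‖ ^ 2 = 0 := by
    rcases mul_eq_zero.mp h with h | h
    · linarith
    · exact h
  have h2 : ∀ j, res H z i j = 0 := fun j => by
    have := (Finset.sum_eq_zero_iff_of_nonneg (fun j _ => by positivity)).mp h1 j (Finset.mem_univ _)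
    simpa using this
  have h3 := congrFun (congrFun (mul_res hH hz) i) i
  rw [Matrix.mul_apply] at h3
  simp [h2] at h3

theorem res_norm_le (hH : H.IsHermitian) (hz : 0 < z.im) (i : n) : ‖res H z i i‖ ≤ 1 / z.im := by
  have h := ward_row hH hz i
  have h1 : ‖res H z i i‖ ^ 2 ≤ ∑ j, ‖res H z i j‖ ^ 2 :=
    Finset.single_le_sum (f := fun j => ‖res H z i j‖ ^ 2) (fun j _ => by positivity) (Finset.mem_univ i)
  have h2 := Complex.im_le_norm (res H z i i)
  have h3 : 0 < ‖res H z i i‖ := norm_pos_iff.mpr (res_ne_zero hH hz i)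
  rw [le_div_iff₀ hz]
  have h4 : z.im * ‖res H z i i‖ ^ 2 ≤ ‖res H z i i‖ := by nlinarith
  by_contra hc
  push Not at hc
  nlinarith

theorem res_half (hH : H.IsHermitian) {z' : ℂ} (hz : 0 < z.im) (hz' : z' = z + (z.im : ℂ) * Complex.I) (i : n) :
    ‖res H z i i‖ ≤ 2 * ‖res H z' i i‖ := by
  have hi : z'.im = 2 * z.im := by rw [hz']; simp; ring
  have hzp : 0 < z'.im := by linarith
  have h1 := mul_res hH hz
  have h2 := res_mul hH hzp
  have h3 : res H z = res H z' - ((z.im : ℂ) * Complex.I) • (res H z * res H z') := by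
    have e : (H - z' • (1 : Matrix n n ℂ)) = (H - z • (1 : Matrix n n ℂ)) - ((z.im : ℂ) * Complex.I) • (1 : Matrix n n ℂ) := by
      rw [hz', add_smul]; abel
    calc res H z = res H z * ((H - z' • (1 : Matrix n n ℂ)) * res H z') := by rw [h2, Matrix.mul_one]
      _ = _ := by
        rw [e, Matrix.sub_mul, Matrix.mul_sub, ← Matrix.mul_assoc, h1, Matrix.one_mul]
        simp
  have h4 := congrFun (congrFun h3 i) i
  rw [Matrix.sub_apply, Matrix.smul_apply, Matrix.mul_apply] at h4
  have h5 := sum_mul_sq_le (fun j => res H z i j) (fun j => res H z' j i)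
  set S := ∑ j, res H z i j * res H z' j i
  set g := ‖res H z' i i‖
  set g' := ‖res H z i i‖
  have h6 : g' ≤ g + z.im * ‖S‖ := by
    calc g' = ‖res H z' i i - ((z.im : ℂ) * Complex.I) • S‖ := by rw [← h4]
      _ ≤ g + ‖((z.im : ℂ) * Complex.I) • S‖ := norm_sub_le _ _
      _ = _ := by simp [abs_of_pos hz]
  have h7 := ward_row hH hz i
  have h8 := ward_col hH hzp i
  have h9 := Complex.im_le_norm (res H z i i)
  have h10 := Complex.im_le_norm (res H z' i i)
  have hX : 0 ≤ ∑ j, ‖res H z i j‖ ^ 2 := Finset.sum_nonneg fun _ _ => by positivity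
  have hY : 0 ≤ ∑ j, ‖res H z' j i‖ ^ 2 := Finset.sum_nonneg fun _ _ => by positivity
  generalize (∑ j, ‖res H z i j‖ ^ 2) = X at *
  generalize (∑ j, ‖res H z' j i‖ ^ 2) = Y at *
  have h11 : (z.im * ‖S‖) ^ 2 * 2 ≤ g' * g := by
    calc (z.im * ‖S‖) ^ 2 * 2 = z.im ^ 2 * 2 * ‖S‖ ^ 2 := by ring
      _ ≤ z.im ^ 2 * 2 * (X * Y) := by gcongr
      _ = (z.im * X) * (2 * z.im * Y) := by ring
      _ ≤ g' * g := by
        apply mul_le_mul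
        · rw [h7]; exact h9
        · rw [← hi, h8]; exact h10
        · positivity
        · positivity
  have hg : 0 ≤ g := norm_nonneg _
  by_contra hc
  push Not at hc
  have hs : 0 ≤ z.im * ‖S‖ := by positivity
  have : z.im * ‖S‖ > g' / 2 := by linarith
  nlinarith

/-- Minor -/
def mnr (H : Matrix n n ℂ) (i : n) : Matrix {j // j ≠ i} {j // j ≠ i} ℂ :=
  H.submatrix Subtype.val Subtype.val

theorem mnr_herm (hH : H.IsHermitian) (i : n) : (mnr H i).IsHermitian := hH.submatrix _

theorem sum_ne (f : n → ℂ) (i : n) : ∑ j : {j // j ≠ i}, f j = ∑ j, f j - f i := by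
  rw [Fintype.sum_eq_add_sum_subtype_ne f i]; ring

theorem mnr_res (hH : H.IsHermitian) (hz : 0 < z.im) (i : n) (j k : {j // j ≠ i}) :
    res (mnr H i) z j k = res H z j k - res H z j i * res H z i k / res H z i i := by
  have hg := res_ne_zero hH hz i
  let B : Matrix {j // j ≠ i} {j // j ≠ i} ℂ :=
    fun j k => res H z j k - res H z j i * res H z i k / res H z i i
  have hB : (mnr H i - z • (1 : Matrix {j // j ≠ i} {j // j ≠ i} ℂ)) * B = 1 := by
    ext a l
    have key : ∀ b : {j // j ≠ i}, (mnr H i - z • (1 : Matrix {j // j ≠ i} {j // j ≠ i} ℂ)) a b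
        = (H - z • (1 : Matrix n n ℂ)) a b := by
      intro b
      simp [mnr, Matrix.one_apply, Subtype.ext_iff]
    have h1 := congrFun (congrFun (res_mul hH hz) a) l
    have h2 := congrFun (congrFun (res_mul hH hz) a) i
    rw [Matrix.mul_apply] at h1 h2 ⊢
    simp_rw [key]
    set A := (H - z • (1 : Matrix n n ℂ))
    rw [Matrix.one_apply_ne a.2] at h2
    have h3 : ∑ b : {j // j ≠ i}, A a b * B b l = ∑ b : {j // j ≠ i},
        (fun b : n => A a b * res H z b l - A a b * res H z b i * (res H z i l / res H z i i)) b := by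
      refine Finset.sum_congr rfl fun b _ => ?_
      simp only [B]; ring
    rw [h3, sum_ne (fun b : n => A a b * res H z b l - A a b * res H z b i * (res H z i l / res H z i i)) i, Finset.sum_sub_distrib, ← Finset.sum_mul, h1, h2]
    simp only [Matrix.one_apply, Subtype.ext_iff]
    field_simp
    ring
  have : res (mnr H i) z = B := Matrix.inv_eq_right_inv hB
  rw [this]

theorem schur (hH : H.IsHermitian) (hz : 0 < z.im) (i : n) :
    1 / res H z i i = H i i - z - ∑ j : {j // j ≠ i}, ∑ k : {j // j ≠ i},
      H i j * res (mnr H i) z j k * H k i := by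
  have hg := res_ne_zero hH hz i
  set A := (H - z • (1 : Matrix n n ℂ)) with hA
  have hAi : ∀ k : {j // j ≠ i}, H k i = A k i := fun k => by simp [hA, Matrix.one_apply_ne k.2]
  have hAi' : ∀ k : {j // j ≠ i}, H i k = A i k := fun k => by
    simp [hA, Matrix.one_apply_ne k.2.symm]
  have hAii : H i i - z = A i i := by simp [hA]
  have h1 : ∀ j : {j // j ≠ i}, ∑ k : {j // j ≠ i}, H i j * res (mnr H i) z j k * H k i
      = - (A i j * res H z j i) / res H z i i := by
    intro j
    have e : ∀ k : {j // j ≠ i}, H i j * res (mnr H i) z j k * H k i =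
        (fun k : n => A i j * (res H z j k * A k i - res H z j i / res H z i i * (res H z i k * A k i))) k := by
      intro k
      rw [mnr_res hH hz, hAi, hAi']; ring
    rw [Finset.sum_congr rfl fun k _ => e k, sum_ne (fun k : n => A i j * (res H z j k * A k i - res H z j i / res H z i i * (res H z i k * A k i))) i, ← Finset.mul_sum, Finset.sum_sub_distrib, ← Finset.mul_sum, ← Matrix.mul_apply,
      ← Matrix.mul_apply, mul_res hH hz, Matrix.one_apply_ne j.2, Matrix.one_apply_eq]
    field_simp
    ring
  simp_rw [h1]
  rw [← Finset.sum_div, Finset.sum_neg_distrib, sum_ne (fun j => A i j * res H z j i), ← Matrix.mul_apply,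
    res_mul hH hz, Matrix.one_apply_eq, hAii]
  field_simp
  ring

theorem trace_mnr (hH : H.IsHermitian) (hz : 0 < z.im) (i : n) :
    ‖(∑ j, res H z j j) - ∑ j : {j // j ≠ i}, res (mnr H i) z j j‖ ≤ 1 / z.im := by
  have hg := res_ne_zero hH hz i
  have e : (∑ j, res H z j j) - ∑ j : {j // j ≠ i}, res (mnr H i) z j j
      = (∑ j, res H z i j * res H z j i) / res H z i i := by
    have : ∀ j : {j // j ≠ i}, res (mnr H i) z j j =
      (fun j : n => res H z j j - (res H z i j * res H z j i) / res H z i i) j := by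
      intro j; rw [mnr_res hH hz]; ring
    rw [Finset.sum_congr rfl fun k _ => this k, sum_ne (fun j : n => res H z j j - (res H z i j * res H z j i) / res H z i i) i, Finset.sum_sub_distrib, ← Finset.sum_div]
    field_simp
    ring
  rw [e, norm_div]
  have h5 := sum_mul_sq_le (fun j => res H z i j) (fun j => res H z j i)
  have h7 := ward_row hH hz i
  have h8 := ward_col hH hz i
  have h9 := Complex.im_le_norm (res H z i i)
  have h3 : 0 < ‖res H z i i‖ := norm_pos_iff.mpr hg
  have hX : 0 ≤ ∑ j, ‖res H z i j‖ ^ 2 := Finset.sum_nonneg fun _ _ => by positivity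
  clear e
  generalize (∑ j, ‖res H z i j‖ ^ 2) = X at *
  generalize (∑ j, ‖res H z j i‖ ^ 2) = Y at *
  generalize (∑ j, res H z i j * res H z j i) = S at *
  have hXY : X = Y := by
    have : z.im * X = z.im * Y := by rw [h7, h8]
    exact mul_left_cancel₀ hz.ne' this
  have h6 : ‖S‖ ≤ X := by
    rw [← hXY, ← sq] at h5
    exact abs_le_of_sq_le_sq' h5 hX |>.2
  rw [div_le_div_iff₀ h3 hz]
  nlinarith

theorem frob (hH : H.IsHermitian) (hz : 0 < z.im) :
    ∑ i, ∑ j, ‖res H z i j‖ ^ 2 = (∑ i, res H z i i).im / z.im := by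
  rw [eq_div_iff hz.ne', mul_comm, Finset.mul_sum, Complex.im_sum]
  exact Finset.sum_congr rfl fun i _ => ward_row hH hz i

theorem eigvec_bound (hH : H.IsHermitian) (hz : 0 < z.im) {v : n → ℂ} {μ : ℝ}
    (hv : ∑ i, ‖v i‖ ^ 2 = 1) (hHv : H *ᵥ v = (μ : ℂ) • v) (hμ : |μ - z.re| ≤ z.im) (i : n) :
    ‖v i‖ ^ 2 ≤ 2 * z.im * ‖res H z i i‖ := by
  have h1 : (H - z • (1 : Matrix n n ℂ)) *ᵥ v = ((μ : ℂ) - z) • v := by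
    rw [Matrix.sub_mulVec, Matrix.smul_mulVec, Matrix.one_mulVec, hHv, sub_smul]
  have h2 : v = ((μ : ℂ) - z) • (res H z *ᵥ v) := by
    rw [← Matrix.mulVec_smul, ← h1, Matrix.mulVec_mulVec, mul_res hH hz, Matrix.one_mulVec]
  have h3 : ‖v i‖ ^ 2 = ‖(μ : ℂ) - z‖ ^ 2 * ‖∑ j, res H z i j * v j‖ ^ 2 := by
    conv_lhs => rw [h2]
    rw [Pi.smul_apply, norm_smul, mul_pow]; rfl
  have h4 := sum_mul_sq_le (fun j => res H z i j) v
  rw [hv, mul_one] at h4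
  have h5 : ‖(μ : ℂ) - z‖ ^ 2 ≤ 2 * z.im ^ 2 := by
    rw [Complex.sq_norm, Complex.normSq_apply]
    simp
    nlinarith [sq_abs (μ - z.re), abs_nonneg (μ - z.re)]
  have h7 := ward_row hH hz i
  have h9 := Complex.im_le_norm (res H z i i)
  set X := ∑ j, ‖res H z i j‖ ^ 2
  have hX : 0 ≤ X := by positivity
  calc ‖v i‖ ^ 2 = _ := h3
    _ ≤ 2 * z.im ^ 2 * X := by gcongr
    _ = 2 * z.im * (z.im * X) := by ring
    _ ≤ _ := by rw [h7]; gcongr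

end DetPart


section Boot
open Matrix

theorem scal (z w d : ℂ) (hzr : |z.re| ≤ 2) (hzi : 0 ≤ z.im) (hwi : 0 ≤ w.im)
    (h : w ^ 2 - z * w + 1 = d) (hd : ‖d‖ ≤ 1 / 1000) (hw : 1 / 8 ≤ ‖w‖) : 2 / 3 ≤ ‖w‖ := by
  by_contra hc
  push Not at hc
  set r := ‖w‖ with hr
  have hr2 : w * (starRingEnd ℂ) w = ((r ^ 2 : ℝ) : ℂ) := by
    rw [Complex.mul_conj']; push_cast; rfl
  have h1 : ((r ^ 2 : ℝ) : ℂ) * w - z * ((r ^ 2 : ℝ) : ℂ) + (starRingEnd ℂ) w = d * (starRingEnd ℂ) w := by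
    rw [← hr2, ← h]; ring
  have hn : ‖d * (starRingEnd ℂ) w‖ ≤ 1 / 1000 * r := by
    rw [norm_mul, RCLike.norm_conj]
    gcongr
  have him := (abs_le.mp (Complex.abs_im_le_norm (d * (starRingEnd ℂ) w)))
  have hre := (abs_le.mp (Complex.abs_re_le_norm (d * (starRingEnd ℂ) w)))
  have e1 := congrArg Complex.im h1
  have e2 := congrArg Complex.re h1
  rw [Complex.add_im, Complex.sub_im, Complex.im_ofReal_mul, Complex.im_mul_ofReal, Complex.conj_im] at e1
  rw [Complex.add_re, Complex.sub_re, Complex.re_ofReal_mul, Complex.re_mul_ofReal, Complex.conj_re] at e2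
  have hrle := Complex.norm_le_abs_re_add_abs_im w
  rw [← hr, abs_of_nonneg hwi] at hrle
  have hr0 : 0 ≤ r := norm_nonneg _
  have a1 : w.im * (1 - r ^ 2) ≤ 1 / 1000 * r := by
    have : 0 ≤ z.im * r ^ 2 := by positivity
    linarith
  have a2 : w.im ≤ 1 / 500 := by
    have b : 1 / 2 ≤ 1 - r ^ 2 := by nlinarith
    have c : w.im * (1 / 2) ≤ w.im * (1 - r ^ 2) := by gcongr
    linarith
  have hz := abs_le.mp hzr
  have a3 : |w.re| * (1 + r ^ 2) ≤ 2 * r ^ 2 + 1 / 1000 * r := by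
    rw [← abs_of_pos (show 0 < 1 + r ^ 2 by positivity), ← abs_mul, abs_le]
    have b1 : z.re * r ^ 2 ≤ 2 * r ^ 2 := by gcongr; exact hz.2
    have b2 : - 2 * r ^ 2 ≤ z.re * r ^ 2 := by gcongr; linarith [hz.1]
    constructor <;> linarith
  have a4 : (r - 1 / 500) * (1 + r ^ 2) ≤ 2 * r ^ 2 + 1 / 1000 * r := by
    refine le_trans ?_ a3
    gcongr
    linarith
  have a5 : 1 / 8 * (1 / 9) ≤ r * (1 - r) ^ 2 := by
    have : (1 / 9 : ℝ) ≤ (1 - r) ^ 2 := by nlinarith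
    gcongr
  nlinarith

theorem boot {N : ℕ} {H : Matrix (Fin N) (Fin N) ℂ} {z : ℂ} {ε : ℝ} (hε : ε ≤ 1 / 1000000)
    (hH : H.IsHermitian) (hz : 0 < z.im)
    (hz1 : z.im ≤ 1 / 2) (hre : |z.re| ≤ 2) (hN : 1 ≤ ε * (N * z.im)) (hN0 : 0 < N)
    (prev : ∀ i, ‖res H (z + (z.im : ℂ) * Complex.I) i i‖ ≤ 2) (hd : ∀ i, ‖H i i‖ ≤ ε)
    (hq : ∀ i, ∑ j, ∑ k, ‖res (mnr H i) z j k / (N : ℂ)‖ ^ 2 ≤ 5 / (N * z.im) →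
      ‖QF (fun j k => res (mnr H i) z j k / (N : ℂ))
        (fun j : {j // j ≠ i} => (Real.sqrt N : ℂ) * H j i)‖ ≤ ε) (i : Fin N) :
    ‖res H z i i‖ ≤ 2 := by
  have hNr : (0 : ℝ) < N := by exact_mod_cast hN0
  have hNc : (N : ℂ) ≠ 0 := by exact_mod_cast hN0.ne'
  have hg4 : ∀ i, ‖res H z i i‖ ≤ 4 := fun i => by
    have := res_half hH hz rfl i
    linarith [prev i]
  obtain ⟨T, hT⟩ : ∃ T, T = ∑ j, res H z j j := ⟨_, rfl⟩
  have hTn : ‖T‖ ≤ 4 * N := by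
    rw [hT]
    refine (norm_sum_le _ _).trans ((Finset.sum_le_sum fun j _ => hg4 j).trans ?_)
    simp [mul_comm]
  have hTi : 0 ≤ T.im := by
    rw [hT, Complex.im_sum]
    exact Finset.sum_nonneg fun j _ => res_im_nonneg hH hz j
  have hηN : 1 / z.im ≤ ε * N := by
    rw [div_le_iff₀ hz]; linarith
  have hε0 : 0 < ε := by
    by_contra hc
    push Not at hc
    have : ε * (N * z.im) ≤ 0 := mul_nonpos_of_nonpos_of_nonneg hc (by positivity)
    linarith
  obtain ⟨w, hw⟩ : ∃ w, w = z + T / N := ⟨_, rfl⟩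
  have key : ∀ i, ‖- (1 / res H z i i) - w‖ ≤ 3 * ε := by
    intro i
    have htr := trace_mnr hH hz i
    rw [← hT] at htr
    obtain ⟨Ti, hTi'⟩ : ∃ Ti, Ti = ∑ j : {j // j ≠ i}, res (mnr H i) z j j := ⟨_, rfl⟩
    rw [← hTi'] at htr
    have hf : ∑ j, ∑ k, ‖res (mnr H i) z j k / (N : ℂ)‖ ^ 2 ≤ 5 / (N * z.im) := by
      have h1 := frob (mnr_herm hH i) hz
      rw [← hTi'] at h1
      have h2 : ∑ j, ∑ k, ‖res (mnr H i) z j k / (N : ℂ)‖ ^ 2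
          = (∑ j, ∑ k, ‖res (mnr H i) z j k‖ ^ 2) / N ^ 2 := by
        rw [Finset.sum_div]
        refine Finset.sum_congr rfl fun j _ => ?_
        rw [Finset.sum_div]
        refine Finset.sum_congr rfl fun k _ => ?_
        rw [norm_div, div_pow, Complex.norm_natCast]
      have h3 : Ti.im ≤ 5 * N := by
        have h4 : Ti.im ≤ ‖T‖ + ‖T - Ti‖ := by
          have a := Complex.im_le_norm Ti
          have b := norm_sub_norm_le Ti T
          rw [norm_sub_rev] at b
          linarith
        nlinarith
      rw [h2, h1, div_div, div_le_div_iff₀ (by positivity) (by positivity)]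
      calc Ti.im * (N * z.im) ≤ 5 * N * (N * z.im) := by gcongr
        _ = _ := by ring
    have hq' := hq i hf
    have hQ : QF (fun j k => res (mnr H i) z j k / (N : ℂ))
        (fun j : {j // j ≠ i} => (Real.sqrt N : ℂ) * H j i) =
        (∑ j : {j // j ≠ i}, ∑ k : {j // j ≠ i}, H i j * res (mnr H i) z j k * H k i) - Ti / N := by
      unfold QF
      rw [hTi', Finset.sum_div]
      congr 1
      refine Finset.sum_congr rfl fun j _ => Finset.sum_congr rfl fun k _ => ?_
      have h1 : (starRingEnd ℂ) (H j i) = H i j := hH.apply i j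
      have h2 : (Real.sqrt N : ℂ) * (Real.sqrt N : ℂ) = N := by
        rw [← Complex.ofReal_mul, Real.mul_self_sqrt hNr.le]; simp
      rw [map_mul, Complex.conj_ofReal, h1]
      field_simp
      linear_combination (H i j * res (mnr H i) z j k * H k i) * h2
    rw [schur hH hz i]
    obtain ⟨Q, hQQ⟩ : ∃ Q, Q = QF (fun j k => res (mnr H i) z j k / (N : ℂ))
        (fun j : {j // j ≠ i} => (Real.sqrt N : ℂ) * H j i) := ⟨_, rfl⟩
    rw [← hQQ] at hq' hQ
    have e : (∑ j : {j // j ≠ i}, ∑ k : {j // j ≠ i}, H i j * res (mnr H i) z j k * H k i) = Q + Ti / N := by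
      rw [hQ]; ring
    rw [e, hw]
    have e2 : -(H i i - z - (Q + Ti / N)) - (z + T / N) = Q - H i i - (T - Ti) / N := by ring
    rw [e2]
    have h5 : ‖(T - Ti) / N‖ ≤ ε := by
      rw [norm_div, Complex.norm_natCast, div_le_iff₀ hNr]
      linarith
    calc _ ≤ ‖Q - H i i‖ + ‖(T - Ti) / N‖ := norm_sub_le _ _
      _ ≤ ‖Q‖ + ‖H i i‖ + ‖(T - Ti) / N‖ := by gcongr; exact norm_sub_le _ _
      _ ≤ 3 * ε := by linarith [hd i]
  have hgi : ∀ i, 1 / 4 ≤ ‖- (1 / res H z i i)‖ := fun i => by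
    rw [norm_neg, norm_div, norm_one]
    exact one_div_le_one_div_of_le (norm_pos_iff.mpr (res_ne_zero hH hz i)) (hg4 i)
  have hw8 : 1 / 8 ≤ ‖w‖ := by
    have h1 := norm_sub_norm_le (- (1 / res H z i i)) w
    have := key i
    have := hgi i
    linarith
  have hw0 : w ≠ 0 := by
    intro h; rw [h, norm_zero] at hw8; norm_num at hw8
  have hzn : ‖z‖ ≤ 5 / 2 := by
    have := Complex.norm_le_abs_re_add_abs_im z
    rw [abs_of_pos hz] at this
    linarith
  have hmn : ‖T / N‖ ≤ 4 := by
    rw [norm_div, Complex.norm_natCast, div_le_iff₀ hNr]; exact hTn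
  have hw7 : ‖w‖ ≤ 7 := by
    rw [hw]
    have := norm_add_le z (T / N)
    linarith
  have hm : ‖T / N + 1 / w‖ ≤ 96 * ε := by
    have h1 : T / N + 1 / w = (∑ j, (res H z j j + 1 / w)) / N := by
      rw [Finset.sum_add_distrib, ← hT]
      simp
      field_simp
    rw [h1, norm_div, Complex.norm_natCast, div_le_iff₀ hNr]
    have h2 : ∀ j, ‖res H z j j + 1 / w‖ ≤ 96 * ε := by
      intro j
      have hg := res_ne_zero hH hz j
      have h3 : res H z j j + 1 / w = res H z j j * (-(- (1 / res H z j j) - w)) / w := by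
        field_simp
        ring
      rw [h3, norm_div, norm_mul, norm_neg, div_le_iff₀ (by linarith)]
      calc _ ≤ 4 * (3 * ε) := by
            gcongr
            · exact hg4 j
            · exact key j
        _ = 96 * ε * (1 / 8) := by ring
        _ ≤ _ := by gcongr
    refine (norm_sum_le _ _).trans ((Finset.sum_le_sum fun j _ => h2 j).trans ?_)
    simp [mul_comm]
  have h23 : 2 / 3 ≤ ‖w‖ := by
    refine scal z w ((T / N + 1 / w) * w) hre hz.le ?_ ?_ ?_ hw8
    · rw [hw, Complex.add_im, Complex.div_natCast_im]
      positivity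
    · have : T / N = w - z := by rw [hw]; ring
      rw [this]
      field_simp
    · rw [norm_mul]
      calc _ ≤ 96 * ε * 7 := by gcongr
        _ ≤ _ := by linarith
  have h1 := norm_sub_norm_le w (- (1 / res H z i i))
  rw [norm_sub_rev] at h1
  have h2 := key i
  have h3 : 1 / 2 ≤ ‖- (1 / res H z i i)‖ := by linarith
  rw [norm_neg, norm_div, norm_one] at h3
  have h4 : 0 < ‖res H z i i‖ := norm_pos_iff.mpr (res_ne_zero hH hz i)
  rw [div_le_div_iff₀ (by norm_num) h4] at h3
  linarith

end Boot


section Concen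

/-- scaled resolvent as a function of the entries -/
def sres {ι : Type} [Fintype ι] [DecidableEq ι] (z c : ℂ) (B : ι → ι → ℂ) : ι → ι → ℂ :=
  fun j k => res (Matrix.of B) z j k / c

variable {ι : Type} [Fintype ι] [DecidableEq ι]

theorem measurable_sres (z c : ℂ) : Measurable (sres z c : (ι → ι → ℂ) → ι → ι → ℂ) := by
  refine measurable_pi_lambda _ fun j => measurable_pi_lambda _ fun k => ?_
  unfold sres res
  have hc : Continuous fun B : ι → ι → ℂ => (Matrix.of B - z • (1 : Matrix ι ι ℂ)) := by
    refine Continuous.sub ?_ continuous_const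
    exact continuous_id
  have h1 : Measurable fun B : ι → ι → ℂ => (Matrix.of B - z • (1 : Matrix ι ι ℂ)).det :=
    (hc.matrix_det).measurable
  have h2 : Measurable fun B : ι → ι → ℂ => (Matrix.of B - z • (1 : Matrix ι ι ℂ)).adjugate j k :=
    ((hc.matrix_adjugate).matrix_elem j k).measurable
  simp only [Matrix.inv_def, Ring.inverse_eq_inv', Matrix.smul_apply, smul_eq_mul]
  exact (h1.inv.mul h2).div_const c

theorem measurable_QF2 {Y : Type*} [MeasurableSpace Y] {f : Y → ι → ι → ℂ} {g : Y → ι → ℂ}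
    (hf : Measurable f) (hg : Measurable g) : Measurable fun y => QF (f y) (g y) := by
  unfold QF
  have hf' : ∀ j k, Measurable fun y => f y j k := fun j k =>
    (measurable_pi_apply k).comp ((measurable_pi_apply j).comp hf)
  have hg' : ∀ j, Measurable fun y => g y j := fun j => (measurable_pi_apply j).comp hg
  have hcg' : ∀ j, Measurable fun y => (starRingEnd ℂ) (g y j) := fun j =>
    Complex.continuous_conj.measurable.comp (hg' j)
  refine Measurable.sub ?_ ?_
  · refine Finset.measurable_sum _ fun j _ => Finset.measurable_sum _ fun k _ => ?_
    exact ((hcg' j).mul (hf' j k)).mul (hg' k)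
  · exact Finset.measurable_sum _ fun j _ => hf' j j

theorem concen {Ω : Type} [MeasurableSpace Ω] {P : Measure Ω} [IsProbabilityMeasure P]
    {X : Ω → ι → ℂ} {Y : Ω → ι → ι → ℂ} (hX : AEMeasurable X P) (hY : AEMeasurable Y P)
    (hind : IndepFun X Y P) {μ : ι → Measure ℂ} [∀ i, IsProbabilityMeasure (μ i)]
    (hmap : P.map X = Measure.pi μ)
    (z c : ℂ) (s ε b : ℝ)
    (hb : ∀ A : ι → ι → ℂ, ∑ j, ∑ k, ‖A j k‖ ^ 2 ≤ s →
      Measure.pi μ {x | ε ≤ ‖QF A x‖} ≤ ENNReal.ofReal b) :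
    P {ω | ∑ j, ∑ k, ‖sres z c (Y ω) j k‖ ^ 2 ≤ s ∧ ε ≤ ‖QF (sres z c (Y ω)) (X ω)‖}
      ≤ ENNReal.ofReal b := by
  have hXY := (indepFun_iff_map_prod_eq_prod_map_map hX hY).mp hind
  let S : Set ((ι → ℂ) × (ι → ι → ℂ)) :=
    {p | ∑ j, ∑ k, ‖sres z c p.2 j k‖ ^ 2 ≤ s ∧ ε ≤ ‖QF (sres z c p.2) p.1‖}
  have hm : Measurable fun p : (ι → ℂ) × (ι → ι → ℂ) => sres z c p.2 :=
    (measurable_sres z c).comp measurable_snd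
  have hS : MeasurableSet S := by
    have m1 : Measurable fun p : (ι → ℂ) × (ι → ι → ℂ) => ∑ j, ∑ k, ‖sres z c p.2 j k‖ ^ 2 := by
      refine Finset.measurable_sum _ fun j _ => Finset.measurable_sum _ fun k _ => ?_
      exact (((measurable_pi_apply k).comp ((measurable_pi_apply j).comp hm)).norm).pow_const 2
    exact (measurableSet_le m1 measurable_const).inter
      (measurableSet_le measurable_const (measurable_QF2 hm measurable_fst).norm)
  have : IsProbabilityMeasure (P.map Y) := Measure.isProbabilityMeasure_map hY
  calc _ = P ((fun ω => (X ω, Y ω)) ⁻¹' S) := rfl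
    _ ≤ (P.map fun ω => (X ω, Y ω)) S := Measure.le_map_apply (hX.prodMk hY) S
    _ = ((Measure.pi μ).prod (P.map Y)) S := by rw [hXY, hmap]
    _ = ∫⁻ y, Measure.pi μ ((fun x => (x, y)) ⁻¹' S) ∂(P.map Y) := Measure.prod_apply_symm hS
    _ ≤ ∫⁻ y, ENNReal.ofReal b ∂(P.map Y) := by
      refine lintegral_mono fun y => ?_
      by_cases h : ∑ j, ∑ k, ‖sres z c y j k‖ ^ 2 ≤ s
      · refine le_trans (measure_mono ?_) (hb _ h)
        intro x hx
        exact hx.2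
      · refine le_trans (le_of_eq ?_) zero_le
        convert measure_empty (μ := Measure.pi μ)
        ext x
        simp only [Set.mem_preimage, Set.mem_empty_iff_false, iff_false]
        exact fun hx => h hx.1
    _ = _ := by simp

theorem SG.conj {δ D : ℝ} {μ : Measure ℂ} (h : SG δ D μ) : SG δ D (μ.map (starRingEnd ℂ)) := by
  have hc : Measurable (starRingEnd ℂ) := Complex.continuous_conj.measurable
  have hp := h.prob
  refine ⟨h.pos, Measure.isProbabilityMeasure_map hc.aemeasurable, ?_, ?_, ?_⟩
  · rw [integral_map hc.aemeasurable (by fun_prop), integral_conj, h.mean, map_zero]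
  · rw [integral_map hc.aemeasurable (by fun_prop)]
    simpa using h.var
  · rw [lintegral_map (by fun_prop) hc]
    simpa using h.mom

end Concen


section Wig

variable {Ω : Type} [MeasurableSpace Ω] {P : Measure Ω} {N : ℕ}
  {H : Ω → Matrix (Fin N) (Fin N) ℂ} {ν : Measure ℂ} {ν' : Measure ℝ}

theorem aemeas_of_map {β : Type} [MeasurableSpace β] {μ : Measure β} [IsProbabilityMeasure μ] {f : Ω → β}
    (h : P.map f = μ) : AEMeasurable f P := by
  by_contra hc
  rw [Measure.map_of_not_aemeasurable hc] at h
  exact IsProbabilityMeasure.ne_zero μ h.symm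

theorem aemeas_entry (hW : IsWignerMatrix P N H ν ν') (hN : 0 < N) (i j : Fin N) (hij : i ≤ j) :
    AEMeasurable (fun ω => H ω i j) P := by
  have := hW.probν
  have := hW.probν'
  have hs : Real.sqrt N ≠ 0 := (Real.sqrt_pos.mpr (by exact_mod_cast hN)).ne'
  have hsc : (Real.sqrt N : ℂ) ≠ 0 := by exact_mod_cast hs
  rcases hij.lt_or_eq with h | h
  · have h1 := aemeas_of_map (hW.offdiag i j h)
    have h2 := h1.const_mul (Real.sqrt N : ℂ)⁻¹
    refine h2.congr (Filter.Eventually.of_forall fun ω => ?_)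
    simp only
    field_simp
  · subst h
    have h1 := aemeas_of_map (hW.diag i)
    have h2 := (h1.const_mul (Real.sqrt N)⁻¹).complex_ofReal
    refine h2.congr (Filter.Eventually.of_forall fun ω => ?_)
    simp only
    rw [inv_mul_cancel_left₀ hs]
    apply Complex.ext
    · simp
    · simp [hW.diag_real]

/-- index of the entry used for column `i` -/
def gidx (i : Fin N) (j : {j : Fin N // j ≠ i}) : {p : Fin N × Fin N // p.1 ≤ p.2} :=
  if h : j.1 < i then ⟨(j.1, i), h.le⟩ else ⟨(i, j.1), not_lt.mp h⟩

theorem gidx_inj (i : Fin N) : Function.Injective (gidx i) := by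
  intro a b hab
  have ha := a.2
  have hb := b.2
  unfold gidx at hab
  split_ifs at hab <;> simp only [Subtype.mk.injEq, Prod.mk.injEq] at hab <;> ext <;> grind

def gfun (i : Fin N) (j : {j : Fin N // j ≠ i}) (w : ℂ) : ℂ :=
  if j.1 < i then (Real.sqrt N : ℂ) * (starRingEnd ℂ) ((starRingEnd ℂ) w) else (Real.sqrt N : ℂ) * (starRingEnd ℂ) w

theorem measurable_gfun (i : Fin N) (j : {j : Fin N // j ≠ i}) : Measurable (gfun i j) := by
  have hc : Measurable (starRingEnd ℂ) := Complex.continuous_conj.measurable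
  unfold gfun
  split_ifs
  · exact (hc.comp hc).const_mul _
  · exact hc.const_mul _

theorem gfun_eq (hW : IsWignerMatrix P N H ν ν') (i : Fin N) (j : {j : Fin N // j ≠ i}) (ω : Ω) :
    gfun i j (H ω (gidx i j).1.1 (gidx i j).1.2) = (Real.sqrt N : ℂ) * H ω j i := by
  unfold gfun gidx
  split_ifs
  · simp
  · have : (starRingEnd ℂ) (H ω i j) = H ω j i := (hW.herm ω).apply j i
    simp [this]

theorem col_map (hW : IsWignerMatrix P N H ν ν') {δ D : ℝ} (hν : SG δ D ν) (hN : 0 < N) (i : Fin N) :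
    ∃ μ : {j : Fin N // j ≠ i} → Measure ℂ, (∀ j, SG δ D (μ j)) ∧
      P.map (fun ω (j : {j : Fin N // j ≠ i}) => (Real.sqrt N : ℂ) * H ω j i) = Measure.pi μ := by
  have := hW.prob
  have := hW.probν
  have hc : Measurable (starRingEnd ℂ) := Complex.continuous_conj.measurable
  refine ⟨fun j => P.map (fun ω => (Real.sqrt N : ℂ) * H ω j i), fun j => ?_, ?_⟩
  · rcases lt_or_gt_of_ne j.2 with h | h
    · show SG δ D (P.map (fun ω => (Real.sqrt N : ℂ) * H ω j i))
      rw [hW.offdiag _ _ h]; exact hν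
    · have h1 := aemeas_of_map (hW.offdiag _ _ h)
      have : (fun ω => (Real.sqrt N : ℂ) * H ω j i) =
          (starRingEnd ℂ) ∘ (fun ω => (Real.sqrt N : ℂ) * H ω i j) := by
        funext ω
        have : (starRingEnd ℂ) (H ω i j) = H ω j i := (hW.herm ω).apply j i
        simp [this]
      show SG δ D (P.map (fun ω => (Real.sqrt N : ℂ) * H ω j i))
      rw [this, ← AEMeasurable.map_map_of_aemeasurable hc.aemeasurable h1, hW.offdiag _ _ h]
      exact hν.conj
  · have h1 := (hW.indep.precomp (gidx_inj i)).comp (fun j => gfun i j) (fun j => measurable_gfun i j)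
    have h2 : iIndepFun (fun (j : {j : Fin N // j ≠ i}) ω => (Real.sqrt N : ℂ) * H ω j i) P := by
      convert h1 using 2 with j
      funext ω
      exact (gfun_eq hW i j ω).symm
    refine (iIndepFun_iff_map_fun_eq_pi_map ?_).mp h2
    intro j
    have h3 := (measurable_gfun i j).comp_aemeasurable
      (aemeas_entry hW hN (gidx i j).1.1 (gidx i j).1.2 (gidx i j).2)
    refine h3.congr (Filter.Eventually.of_forall fun ω => ?_)
    exact gfun_eq hW i j ω

theorem col_indep (hW : IsWignerMatrix P N H ν ν') (hN : 0 < N) (i : Fin N) :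
    IndepFun (fun ω (j : {j : Fin N // j ≠ i}) => (Real.sqrt N : ℂ) * H ω j i)
      (fun ω (j k : {j : Fin N // j ≠ i}) => H ω j k) P ∧
    AEMeasurable (fun ω (j : {j : Fin N // j ≠ i}) => (Real.sqrt N : ℂ) * H ω j i) P ∧
    AEMeasurable (fun ω (j k : {j : Fin N // j ≠ i}) => H ω j k) P := by
  classical
  have := hW.prob
  have hc : Measurable (starRingEnd ℂ) := Complex.continuous_conj.measurable
  have hae : ∀ p : {p : Fin N × Fin N // p.1 ≤ p.2}, AEMeasurable (fun ω => H ω p.1.1 p.1.2) P :=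
    fun p => aemeas_entry hW hN _ _ p.2
  let S : Finset {p : Fin N × Fin N // p.1 ≤ p.2} := Finset.univ.filter fun p => p.1.1 = i ∨ p.1.2 = i
  let T : Finset {p : Fin N × Fin N // p.1 ≤ p.2} := Finset.univ.filter fun p => p.1.1 ≠ i ∧ p.1.2 ≠ i
  have hST : Disjoint S T := by
    rw [Finset.disjoint_left]
    intro p hp hp'
    simp only [S, T, Finset.mem_filter, Finset.mem_univ, true_and] at hp hp'
    tauto
  have h0 := hW.indep.indepFun_finset₀ S T hST hae
  have hS : ∀ j, gidx i j ∈ S := fun j => by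
    simp only [S, Finset.mem_filter, Finset.mem_univ, true_and, gidx]
    split_ifs <;> simp
  have hT1 : ∀ (j k : {j : Fin N // j ≠ i}) (h : j.1 ≤ k.1), (⟨(j.1, k.1), h⟩ : {p : Fin N × Fin N // p.1 ≤ p.2}) ∈ T :=
    fun j k h => by simp [T, j.2, k.2]
  let φ : (S → ℂ) → {j : Fin N // j ≠ i} → ℂ := fun f j => gfun i j (f ⟨gidx i j, hS j⟩)
  let ψ : (T → ℂ) → {j : Fin N // j ≠ i} → {j : Fin N // j ≠ i} → ℂ := fun f j k =>
    if h : j.1 ≤ k.1 then f ⟨_, hT1 j k h⟩ else (starRingEnd ℂ) (f ⟨_, hT1 k j (not_le.mp h).le⟩)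
  have hφ : Measurable φ := measurable_pi_lambda _ fun j =>
    (measurable_gfun i j).comp (measurable_pi_apply _)
  have hψ : Measurable ψ := measurable_pi_lambda _ fun j => measurable_pi_lambda _ fun k => by
    simp only [ψ]
    split_ifs
    · exact measurable_pi_apply _
    · exact hc.comp (measurable_pi_apply _)
  have e1 : (fun ω (j : {j : Fin N // j ≠ i}) => (Real.sqrt N : ℂ) * H ω j i) =
      φ ∘ (fun ω (p : S) => H ω p.1.1.1 p.1.1.2) := by
    funext ω j
    exact (gfun_eq hW i j ω).symm
  have e2 : (fun ω (j k : {j : Fin N // j ≠ i}) => H ω j k) =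
      ψ ∘ (fun ω (p : T) => H ω p.1.1.1 p.1.1.2) := by
    funext ω j k
    simp only [ψ, Function.comp]
    split_ifs
    · rfl
    · exact ((hW.herm ω).apply j k).symm
  rw [e1, e2]
  refine ⟨h0.comp hφ hψ, hφ.comp_aemeasurable ?_, hψ.comp_aemeasurable ?_⟩
  · exact aemeasurable_pi_lambda _ fun p => hae p.1
  · exact aemeasurable_pi_lambda _ fun p => hae p.1

/-- bad event -/
def Bad (H : Ω → Matrix (Fin N) (Fin N) ℂ) (ε s : ℝ) (i : Fin N) (z : ℂ) : Set Ω :=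
  {ω | ∑ j, ∑ k, ‖res (mnr (H ω) i) z j k / (N : ℂ)‖ ^ 2 ≤ s ∧
      ε ≤ ‖QF (fun j k => res (mnr (H ω) i) z j k / (N : ℂ))
        (fun j : {j // j ≠ i} => (Real.sqrt N : ℂ) * H ω j i)‖}

theorem bad_prob {δ D τ K : ℝ} (hHW : ∀ (ι : Type) (_ : Fintype ι) (_ : DecidableEq ι) (μ : ι → Measure ℂ),
      (∀ i, SG δ D (μ i)) → ∀ (A : ι → ι → ℂ) (σ ε : ℝ), 0 < σ → ∑ j, ∑ k, ‖A j k‖ ^ 2 ≤ σ ^ 2 →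
      Measure.pi μ {z | ε ≤ ‖QF A z‖} ≤ ENNReal.ofReal (K * Real.exp (-(τ * ε / σ))))
    (hW : IsWignerMatrix P N H ν ν') (hν : SG δ D ν) (hN : 0 < N) (i : Fin N) (z : ℂ)
    (ε s σ : ℝ) (hσ : 0 < σ) (hs : s ≤ σ ^ 2) :
    P (Bad H ε s i z) ≤ ENNReal.ofReal (K * Real.exp (-(τ * ε / σ))) := by
  have := hW.prob
  obtain ⟨μ, hμ, hmap⟩ := col_map hW hν hN i
  obtain ⟨h1, h2, h3⟩ := col_indep hW hN i
  have : ∀ j, IsProbabilityMeasure (μ j) := fun j => (hμ j).prob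
  exact concen h2 h3 h1 hmap z N s ε _ (fun A hA => hHW _ _ inferInstance μ hμ A σ ε hσ (hA.trans hs))

theorem diag_prob (hW : IsWignerMatrix P N H ν ν') {δ D' : ℝ} (hδ : 0 < δ)
    (h : (∫⁻ x, ENNReal.ofReal (Real.exp (δ * x ^ 2)) ∂ν') ≤ ENNReal.ofReal D')
    (i : Fin N) (ε : ℝ) (hε : 0 < ε) :
    P {ω | ε < ‖H ω i i‖} ≤ ENNReal.ofReal (|D'| * Real.exp (-(δ * (ε ^ 2 * N)))) := by
  have := hW.probν'
  have hm := aemeas_of_map (hW.diag i)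
  have h1 : P {ω | ε < ‖H ω i i‖} ≤ ν' {x | EE (δ * (ε ^ 2 * N)) ≤ EE (δ * x ^ 2)} := by
    rw [← hW.diag i]
    refine le_trans (measure_mono ?_) (Measure.le_map_apply hm _)
    intro ω hω
    simp only [Set.mem_ofPred_eq, Set.mem_preimage] at hω ⊢
    apply EE_mono
    have h2 : ‖H ω i i‖ = |(H ω i i).re| := by
      have : H ω i i = ((H ω i i).re : ℂ) := by
        apply Complex.ext
        · simp
        · simp [hW.diag_real]
      rw [this]; simp
    rw [h2] at hω
    rw [mul_pow, Real.sq_sqrt (Nat.cast_nonneg N), mul_comm (N : ℝ), ← sq_abs (H ω i i).re]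
    gcongr
  refine h1.trans ?_
  have h3 := meas_ge_le_lintegral_div (μ := ν') (f := fun x => EE (δ * x ^ 2))
    (measurable_EE.comp (by fun_prop)).aemeasurable (ε := EE (δ * (ε ^ 2 * N)))
    (by simp [EE, Real.exp_pos]) (EE_ne_top _)
  refine h3.trans ?_
  rw [ENNReal.ofReal_mul (abs_nonneg _), Real.exp_neg, ENNReal.ofReal_inv_of_pos (Real.exp_pos _),
    ENNReal.div_eq_inv_mul, mul_comm]
  gcongr
  · exact h.trans (ENNReal.ofReal_le_ofReal (le_abs_self _))
  · exact le_rfl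

end Wig


section Fin1

/-- spectral parameter at dyadic scale -/
def zk (E : ℝ) (k : ℕ) : ℂ := ⟨E, (1 / 2) ^ (k + 1)⟩

theorem scales {N : ℕ} {A : Matrix (Fin N) (Fin N) ℂ} {ε : ℝ} (hε : ε ≤ 1 / 1000000)
    (hA : A.IsHermitian) (hN0 : 0 < N) (n : ℕ) (hn : 1 ≤ ε * (N * (1 / 2) ^ (n + 1)))
    (hε0 : 0 < ε) (hd : ∀ i, ‖A i i‖ ≤ ε) (E : ℝ) (hE : |E| ≤ 2)
    (hq : ∀ i k, k ≤ n →
      ∑ j, ∑ k', ‖res (mnr A i) (zk E k) j k' / (N : ℂ)‖ ^ 2 ≤ 5 / (N * (1 / 2) ^ (k + 1)) →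
      ‖QF (fun j k' => res (mnr A i) (zk E k) j k' / (N : ℂ))
        (fun j : {j // j ≠ i} => (Real.sqrt N : ℂ) * A j i)‖ ≤ ε) (k : ℕ) (hk : k ≤ n) :
    ∀ i, ‖res A (zk E k) i i‖ ≤ 2 := by
  induction k with
  | zero =>
    intro i
    have := res_norm_le (z := zk E 0) hA (by simp [zk]) i
    refine this.trans ?_
    simp [zk]
  | succ k ih =>
    have him : (zk E (k + 1)).im = (1 / 2) ^ (k + 1 + 1) := rfl
    refine boot hε hA ?_ ?_ hE ?_ hN0 ?_ hd (fun i => ?_)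
    · rw [him]; positivity
    · rw [him, pow_succ]
      have : ((1 : ℝ) / 2) ^ (k + 1) ≤ 1 := pow_le_one₀ (by norm_num) (by norm_num)
      linarith
    · rw [him]
      refine hn.trans ?_
      have : ((1 : ℝ) / 2) ^ (n + 1) ≤ (1 / 2) ^ (k + 1 + 1) :=
        pow_le_pow_of_le_one (by norm_num) (by norm_num) (by omega)
      gcongr
    · have e : zk E (k + 1) + ((zk E (k + 1)).im : ℂ) * Complex.I = zk E k := by
        apply Complex.ext
        · rw [Complex.add_re, Complex.re_ofReal_mul, Complex.I_re, mul_zero, add_zero]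
          rfl
        · rw [Complex.add_im, Complex.im_ofReal_mul, Complex.I_im, mul_one, him]
          show (1 / 2 : ℝ) ^ (k + 1 + 1) + (1 / 2) ^ (k + 1 + 1) = (1 / 2) ^ (k + 1)
          rw [pow_succ _ (k + 1)]; ring
      rw [e]
      exact ih (by omega)
    · rw [him]; exact hq i (k + 1) hk

theorem incl {N : ℕ} {A : Matrix (Fin N) (Fin N) ℂ} {ε : ℝ} (hε : ε ≤ 1 / 1000000)
    (hA : A.IsHermitian) (hN0 : 0 < N) (n : ℕ) (hn : 1 ≤ ε * (N * (1 / 2) ^ (n + 1)))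
    (hε0 : 0 < ε) (hd : ∀ i, ‖A i i‖ ≤ ε)
    (hq : ∀ i (l : ℤ) k, -(2 * N : ℤ) ≤ l → l ≤ 2 * N → k ≤ n →
      ∑ j, ∑ k', ‖res (mnr A i) (zk (l / N) k) j k' / (N : ℂ)‖ ^ 2 ≤ 5 / (N * (1 / 2) ^ (k + 1)) →
      ‖QF (fun j k' => res (mnr A i) (zk (l / N) k) j k' / (N : ℂ))
        (fun j : {j // j ≠ i} => (Real.sqrt N : ℂ) * A j i)‖ ≤ ε)
    (μ : ℝ) (hμ1 : -2 ≤ μ) (hμ2 : μ ≤ 2) (v : Fin N → ℂ) (hv : ∑ i, ‖v i‖ ^ 2 = 1)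
    (hAv : A.mulVec v = (μ : ℂ) • v) (i : Fin N) : ‖v i‖ ^ 2 ≤ 4 * (1 / 2) ^ (n + 1) := by
  have hNr : (0 : ℝ) < N := by exact_mod_cast hN0
  obtain ⟨l, hl⟩ : ∃ l : ℤ, l = ⌊μ * N⌋ := ⟨_, rfl⟩
  have h1 : (l : ℝ) ≤ μ * N := by rw [hl]; exact Int.floor_le _
  have h2 : μ * N < l + 1 := by rw [hl]; exact Int.lt_floor_add_one _
  have hl1 : -(2 * N : ℤ) ≤ l := by
    rw [hl, Int.le_floor]; push_cast; nlinarith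
  have hl2 : l ≤ 2 * N := by
    have : (l : ℝ) ≤ 2 * N := by nlinarith
    exact_mod_cast this
  have hE : |(l / N : ℝ)| ≤ 2 := by
    rw [abs_le, le_div_iff₀ hNr, div_le_iff₀ hNr]
    have a : (-(2 * N : ℤ) : ℝ) ≤ l := by exact_mod_cast hl1
    have b : (l : ℝ) ≤ (2 * N : ℤ) := by exact_mod_cast hl2
    push_cast at a b
    constructor <;> linarith
  have h3 := scales hε hA hN0 n hn hε0 hd (l / N) hE (fun i k hk => hq i l k hl1 hl2 hk) n le_rfl i
  have him : (zk (l / N) n).im = (1 / 2) ^ (n + 1) := rfl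
  have h4 := eigvec_bound (z := zk (l / N) n) hA (by rw [him]; positivity) hv hAv ?_ i
  · rw [him] at h4
    refine h4.trans ?_
    have : (0 : ℝ) < (1 / 2) ^ (n + 1) := by positivity
    nlinarith
  · show |μ - l / N| ≤ (1 / 2) ^ (n + 1)
    have h5 : |μ - l / N| ≤ 1 / N := by
      have e : μ - l / N = (μ * N - l) / N := by field_simp
      rw [e, abs_of_nonneg (div_nonneg (by linarith) hNr.le)]
      gcongr
      linarith
    refine h5.trans ?_
    rw [div_le_iff₀ hNr]
    have : (0 : ℝ) < N * (1 / 2) ^ (n + 1) := by positivity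
    nlinarith

theorem pick_n (N : ℕ) (M : ℝ) (hM : 8 ≤ M ^ 2) (hMN : M ^ 2 ≤ N) : ∃ n : ℕ,
    4 * (1 / 2 : ℝ) ^ (n + 1) < M ^ 2 / N ∧ M ^ 2 / (8 * N) ≤ (1 / 2 : ℝ) ^ (n + 1) ∧ n ≤ N := by
  have hNr : (0 : ℝ) < N := by linarith
  have hex : ∃ n : ℕ, 4 * (1 / 2 : ℝ) ^ (n + 1) < M ^ 2 / N := by
    obtain ⟨n, hn⟩ := exists_pow_lt_of_lt_one (show 0 < M ^ 2 / N / 2 by positivity) (show (1 / 2 : ℝ) < 1 by norm_num)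
    exact ⟨n, by rw [pow_succ]; linarith⟩
  classical
  have key : M ^ 2 / (8 * N) ≤ (1 / 2 : ℝ) ^ (Nat.find hex + 1) := by
    rcases Nat.eq_zero_or_pos (Nat.find hex) with h | h
    · rw [h, div_le_iff₀ (by positivity)]
      linarith
    · have h1 := Nat.find_min hex (m := Nat.find hex - 1) (by omega)
      have e1 : Nat.find hex - 1 + 1 = Nat.find hex := by omega
      rw [e1, not_lt] at h1
      clear e1
      generalize Nat.find hex = q at *
      rw [pow_succ _ q]
      have : M ^ 2 / (8 * N) = M ^ 2 / N / 8 := by field_simp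
      rw [this]; linarith
  have hsp := Nat.find_spec hex
  generalize Nat.find hex = n at *
  refine ⟨n, hsp, key, ?_⟩
  rw [div_le_iff₀ (by positivity), one_div, inv_pow, ← div_eq_inv_mul, le_div_iff₀ (by positivity)] at key
  have h2 : (2 : ℝ) ^ (n + 1) ≤ N := by
    have : (0 : ℝ) < 2 ^ (n + 1) := by positivity
    nlinarith
  have h3 : n + 1 < 2 ^ (n + 1) := Nat.lt_two_pow_self
  have h4 : 2 ^ (n + 1) ≤ N := by exact_mod_cast h2
  omega

theorem final_arith {a b K D' s N n : ℝ} (ha : 0 < a) (hb : 0 < b) (hK : 0 < K) (hD : 0 ≤ D')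
    (hs1 : 1 ≤ s) (hs2 : 5 / a ≤ s) (hs3 : 20 * K ≤ s) (hs4 : 3 / b ≤ s) (hs5 : 2 * D' ≤ s)
    (hN : N ≤ Real.exp s) (hN1 : 1 ≤ N) (hNs : s ^ 2 ≤ N) (hn : n ≤ N) (hn0 : 0 ≤ n) :
    N * ((4 * N + 1) * (n + 1)) * (K * Real.exp (-(a * s ^ 2))) + N * (D' * Real.exp (-(b * N)))
      ≤ Real.exp (-s) := by
  have hse : s ≤ Real.exp s := by linarith [Real.add_one_le_exp s]
  have h0 : 5 * s ≤ a * s ^ 2 := by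
    rw [div_le_iff₀ ha] at hs2; nlinarith
  have h0' : 3 * s ≤ b * N := by
    rw [div_le_iff₀ hb] at hs4
    have : b * s ^ 2 ≤ b * N := by gcongr
    nlinarith
  have h1 : Real.exp (-(a * s ^ 2)) ≤ Real.exp (-(5 * s)) := Real.exp_le_exp.mpr (by linarith)
  have h1' : Real.exp (-(b * N)) ≤ Real.exp (-(3 * s)) := Real.exp_le_exp.mpr (by linarith)
  have h2 : N * ((4 * N + 1) * (n + 1)) ≤ 10 * Real.exp s ^ 3 := by
    calc N * ((4 * N + 1) * (n + 1)) ≤ N * ((4 * N + N) * (N + N)) := by gcongr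
      _ = 10 * N ^ 3 := by ring
      _ ≤ _ := by gcongr
  set x := Real.exp s with hx
  have hx0 : 0 < x := Real.exp_pos s
  have e5 : Real.exp (-(5 * s)) = (x ^ 5)⁻¹ := by
    rw [Real.exp_neg, hx, ← Real.exp_nat_mul]; norm_num
  have e3 : Real.exp (-(3 * s)) = (x ^ 3)⁻¹ := by
    rw [Real.exp_neg, hx, ← Real.exp_nat_mul]; norm_num
  rw [e5] at h1
  rw [e3] at h1'
  calc _ ≤ 10 * x ^ 3 * (K * (x ^ 5)⁻¹) + x * (D' * (x ^ 3)⁻¹) := by gcongr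
    _ = (10 * K + D') / x ^ 2 := by field_simp
    _ ≤ Real.exp (-s) := by
      rw [Real.exp_neg, ← hx, div_le_iff₀ (by positivity)]
      have : x⁻¹ * x ^ 2 = x := by field_simp
      rw [this]; linarith

theorem large_params (s₀ : ℝ) (hs₀ : 1 ≤ s₀) : ∃ N₀ : ℕ, ∀ N : ℕ, N₀ ≤ N → ∀ M : ℝ, Real.log N ^ 4 ≤ M →
    s₀ ≤ Real.sqrt M ∧ (N : ℝ) ≤ Real.exp (Real.sqrt M) := by
  refine ⟨⌈Real.exp s₀⌉₊, fun N hN M hM => ?_⟩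
  have h1 : Real.exp s₀ ≤ N := Nat.ceil_le.mp hN
  have hN0 : (0 : ℝ) < N := (Real.exp_pos _).trans_le h1
  have h2 : s₀ ≤ Real.log N := (Real.le_log_iff_exp_le hN0).mpr h1
  have h3 : Real.log N ≤ Real.sqrt M := by
    apply Real.le_sqrt_of_sq_le
    refine le_trans ?_ hM
    exact pow_le_pow_right₀ (by linarith) (by norm_num)
  refine ⟨h2.trans h3, ?_⟩
  calc (N : ℝ) = Real.exp (Real.log N) := (Real.exp_log hN0).symm
    _ ≤ _ := Real.exp_le_exp.mpr h3

end Fin1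

/-- **Complete delocalization of eigenvectors (`ℓ^∞`-bound), for large `N`.** -/
theorem stmt_17 :
    ∀ κ δ₀ D D' : ℝ, 0 < κ →
    ∃ C c : ℝ, 0 < C ∧ 0 < c ∧ ∃ N₀ : ℕ,
    ∀ (N : ℕ) (Ω : Type) (_ : MeasurableSpace Ω) (P : Measure Ω)
      (H : Ω → Matrix (Fin N) (Fin N) ℂ) (ν : Measure ℂ) (ν' : Measure ℝ),
      N₀ ≤ N →
      IsWignerMatrix P N H ν ν' →
      CondC1 ν ν' δ₀ D D' →
      ∀ M : ℝ, (Real.log N) ^ 4 ≤ M →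
        P {ω | ∃ μ ∈ Set.Icc (-2 + κ) (2 - κ), ∃ v : Fin N → ℂ,
            (∑ i, ‖v i‖ ^ 2) = 1 ∧
            (H ω).mulVec v = (μ : ℂ) • v ∧
            ∃ i, M / Real.sqrt N ≤ ‖v i‖}
          ≤ ENNReal.ofReal (C * Real.exp (-(c * Real.sqrt M))) := by
  intro κ δ₀ D D' hκ
  by_cases hδ : 0 < δ₀
  swap
  · exact ⟨1, 1, one_pos, one_pos, 0, fun N Ω _ P H ν ν' _ _ hC => absurd hC.1 hδ⟩
  obtain ⟨τ, K, hτ, hK, hHW⟩ := HW_tail δ₀ (max D 1) hδ (le_max_right _ _)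
  obtain ⟨ε, hεdef⟩ : ∃ ε : ℝ, ε = 1 / 1000000 := ⟨_, rfl⟩
  have hε0 : 0 < ε := by rw [hεdef]; norm_num
  obtain ⟨a, hadef⟩ : ∃ a : ℝ, a = τ * ε / 7 := ⟨_, rfl⟩
  obtain ⟨b, hbdef⟩ : ∃ b : ℝ, b = δ₀ * ε ^ 2 := ⟨_, rfl⟩
  have ha : 0 < a := by rw [hadef]; positivity
  have hb : 0 < b := by rw [hbdef]; positivity
  obtain ⟨N₀, hN₀⟩ := large_params (100 + 5 / a + 20 * K + 3 / b + 2 * |D'|) (by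
    have : 0 < 5 / a := by positivity
    have : 0 < 3 / b := by positivity
    have := abs_nonneg D'
    linarith)
  refine ⟨1, 1, one_pos, one_pos, N₀, fun N Ω _ P H ν ν' hN hW hC M hM => ?_⟩
  have := hW.prob
  obtain ⟨hs0, hNs⟩ := hN₀ N hN M hM
  have p1 : 0 < 5 / a := by positivity
  have p2 : 0 < 3 / b := by positivity
  have p3 := abs_nonneg D'
  obtain ⟨s, hs⟩ : ∃ s, s = Real.sqrt M := ⟨_, rfl⟩
  rw [← hs] at hs0 hNs
  have hM0 : 0 < M := by
    by_contra hc
    rw [Real.sqrt_eq_zero_of_nonpos (not_lt.mp hc)] at hs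
    linarith
  have hMs : s ^ 2 = M := by rw [hs, Real.sq_sqrt hM0.le]
  have hM4 : 10000 ≤ M := by rw [← hMs]; nlinarith
  rw [one_mul, one_mul, ← hs]
  by_cases hMN : M ^ 2 ≤ N
  swap
  · push Not at hMN
    refine le_trans (le_of_eq ?_) zero_le
    convert measure_empty (μ := P)
    rw [Set.eq_empty_iff_forall_notMem]
    rintro ω ⟨μ, hμ, v, hv, hHv, i, hi⟩
    have h1 : ‖v i‖ ^ 2 ≤ 1 := by
      rw [← hv]
      exact Finset.single_le_sum (f := fun i => ‖v i‖ ^ 2) (fun j _ => by positivity) (Finset.mem_univ i)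
    have hNpos : (0 : ℝ) < N := by
      have := i.pos
      exact_mod_cast this
    have h2 : (M / Real.sqrt N) ^ 2 ≤ ‖v i‖ ^ 2 := by gcongr
    rw [div_pow, Real.sq_sqrt hNpos.le] at h2
    have h3 : 1 < M ^ 2 / N := by rw [lt_div_iff₀ hNpos]; linarith
    linarith
  have hNr : (0 : ℝ) < N := by nlinarith
  have hN0 : 0 < N := by exact_mod_cast hNr
  obtain ⟨n, hn1, hn2, hn3⟩ := pick_n N M (by nlinarith) hMN
  have hν : SG δ₀ (max D 1) ν :=
    ⟨hδ, hW.probν, hW.mean, hW.var, hC.2.1.trans (ENNReal.ofReal_le_ofReal (le_max_left _ _))⟩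
  let F : Finset (Fin N × (ℤ × ℕ)) :=
    Finset.univ ×ˢ (Finset.Icc (-(2 * N : ℤ)) (2 * N) ×ˢ Finset.range (n + 1))
  let B : Fin N × (ℤ × ℕ) → Set Ω := fun x =>
    Bad H ε (5 / (N * (1 / 2) ^ (x.2.2 + 1))) x.1 (zk (x.2.1 / N) x.2.2)
  have hsub : {ω | ∃ μ ∈ Set.Icc (-2 + κ) (2 - κ), ∃ v : Fin N → ℂ,
            (∑ i, ‖v i‖ ^ 2) = 1 ∧
            (H ω).mulVec v = (μ : ℂ) • v ∧
            ∃ i, M / Real.sqrt N ≤ ‖v i‖} ⊆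
      (⋃ x ∈ F, B x) ∪ ⋃ i ∈ (Finset.univ : Finset (Fin N)), {ω | ε < ‖H ω i i‖} := by
    rintro ω ⟨μ, hμ, v, hv, hHv, i, hi⟩
    by_contra hc
    simp only [Set.mem_union, Set.mem_iUnion, not_or, not_exists] at hc
    obtain ⟨hc1, hc2⟩ := hc
    have h2 : (M / Real.sqrt N) ^ 2 ≤ ‖v i‖ ^ 2 := by gcongr
    rw [div_pow, Real.sq_sqrt hNr.le] at h2
    have h3 : 1 ≤ ε * (N * (1 / 2) ^ (n + 1)) := by
      have : M ^ 2 / 8 ≤ N * (1 / 2) ^ (n + 1) := by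
        calc M ^ 2 / 8 = N * (M ^ 2 / (8 * N)) := by field_simp
          _ ≤ _ := by gcongr
      calc 1 ≤ ε * (M ^ 2 / 8) := by rw [hεdef]; nlinarith
        _ ≤ _ := by gcongr
    have h4 := incl (le_of_eq hεdef) (hW.herm ω) hN0 n h3 hε0
      (fun j => not_lt.mp (hc2 j (Finset.mem_univ j))) ?_ μ (by linarith [hμ.1]) (by linarith [hμ.2])
      v hv hHv i
    · linarith
    · intro j l k hl1 hl2 hk hf
      by_contra hcc
      refine hc1 (j, (l, k)) ?_ ⟨hf, (not_le.mp hcc).le⟩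
      simp only [F, Finset.mem_product, Finset.mem_univ, true_and, Finset.mem_Icc, Finset.mem_range]
      exact ⟨⟨hl1, hl2⟩, by omega⟩
  have hB : ∀ x ∈ F, P (B x) ≤ ENNReal.ofReal (K * Real.exp (-(a * s ^ 2))) := by
    rintro ⟨i, l, k⟩ hx
    simp only [F, Finset.mem_product, Finset.mem_univ, true_and, Finset.mem_Icc, Finset.mem_range] at hx
    have h1 := bad_prob hHW hW hν hN0 i (zk (l / N) k) ε (5 / (N * (1 / 2) ^ (k + 1))) (7 / M)
      (by positivity) ?_
    · have e : τ * ε / (7 / M) = a * s ^ 2 := by rw [hMs, hadef]; field_simp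
      rw [e] at h1
      exact h1
    · have h2 : ((1 : ℝ) / 2) ^ (n + 1) ≤ (1 / 2) ^ (k + 1) :=
        pow_le_pow_of_le_one (by norm_num) (by norm_num) (by omega)
      have h3 : M ^ 2 / 8 ≤ N * (1 / 2) ^ (k + 1) := by
        calc M ^ 2 / 8 = N * (M ^ 2 / (8 * N)) := by field_simp
          _ ≤ _ := by gcongr; exact hn2.trans h2
      calc 5 / (N * (1 / 2) ^ (k + 1)) ≤ 5 / (M ^ 2 / 8) := by gcongr
        _ = 40 / M ^ 2 := by field_simp; norm_num
        _ ≤ 49 / M ^ 2 := by gcongr; norm_num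
        _ = (7 / M) ^ 2 := by rw [div_pow]; norm_num
  have hcard : (F.card : ℝ) = N * ((4 * N + 1) * (n + 1)) := by
    simp only [F, Finset.card_product, Finset.card_univ, Fintype.card_fin, Int.card_Icc, Finset.card_range]
    have : ((2 * N : ℤ) + 1 - -(2 * N : ℤ)).toNat = 4 * N + 1 := by omega
    rw [this]
    push_cast
    ring
  refine (measure_mono hsub).trans ((measure_union_le _ _).trans ?_)
  have hU1 : P (⋃ x ∈ F, B x) ≤ ENNReal.ofReal (N * ((4 * N + 1) * (n + 1)) * (K * Real.exp (-(a * s ^ 2)))) := by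
    refine (measure_biUnion_finset_le F B).trans ((Finset.sum_le_sum hB).trans ?_)
    rw [Finset.sum_const, nsmul_eq_mul, ← hcard, ENNReal.ofReal_mul (Nat.cast_nonneg _), ENNReal.ofReal_natCast]
  have hU2 : P (⋃ i ∈ (Finset.univ : Finset (Fin N)), {ω | ε < ‖H ω i i‖}) ≤
      ENNReal.ofReal (N * (|D'| * Real.exp (-(b * N)))) := by
    refine (measure_biUnion_finset_le _ _).trans
      ((Finset.sum_le_sum fun i _ => diag_prob hW hδ hC.2.2 i ε hε0).trans ?_)
    rw [Finset.sum_const, nsmul_eq_mul, Finset.card_univ, Fintype.card_fin,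
      ENNReal.ofReal_mul (Nat.cast_nonneg _), ENNReal.ofReal_natCast, hbdef, mul_assoc δ₀]
  refine (add_le_add hU1 hU2).trans ?_
  rw [← ENNReal.ofReal_add (by positivity) (by positivity)]
  refine ENNReal.ofReal_le_ofReal (final_arith ha hb hK p3 ?_ ?_ ?_ ?_ ?_ hNs ?_ ?_ ?_ ?_)
  · linarith
  · linarith
  · linarith
  · linarith
  · linarith
  · exact_mod_cast hN0
  · rw [hMs]; nlinarith
  · exact_mod_cast hn3
  · positivity

end
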